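/- Reverse spectral isochoric inequality in the exterior (Theorem 1, second part): Let α < 0 and let Ω ⊂ ℝ² be a nonempty convex bounded open set with smooth boundary. Let B_{R₂} ⊂ ℝ² be an open disk whose area (2-dimensional Lebesgue measure) equals that of Ω, i.e. |B_{R₂}| = |Ω|. Then λ₁^α(Ω^ext) ≤ λ₁^α(B_{R₂}^ext). -/

import Mathlib

open MeasureTheory Metric Set Bornology Real Filter

noncomputable section

/-- The Euclidean plane. -/
abbrev E2 := EuclideanSpace ℝ (Fin 2)

/-- The exterior of a set: complement of its closure. -/
def extDom (Ω : Set E2) : Set E2 := (closure Ω)ᶜ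

/-- The lowest Robin eigenvalue of the exterior of `Ω`, defined variationally as the
infimum of Rayleigh quotients over smooth compactly supported test functions that are
not identically zero on the exterior. -/
def robinEig (α : ℝ) (Ω : Set E2) : ℝ :=
  sInf { q : ℝ | ∃ u : E2 → ℝ, ContDiff ℝ (⊤ : ℕ∞) u ∧ HasCompactSupport u ∧
    (∃ x ∈ extDom Ω, u x ≠ 0) ∧
    q = ((∫ x in extDom Ω, ‖fderiv ℝ u x‖ ^ 2) +
          α * ∫ x in frontier Ω, (u x) ^ 2 ∂(μH[1])) /
        (∫ x in extDom Ω, (u x) ^ 2) }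

/-- A planar set has smooth boundary if its topological boundary is the image of a
smooth, periodic, regular, injective (on one period) closed curve. -/
def HasSmoothBoundary (Ω : Set E2) : Prop :=
  ∃ γ : ℝ → E2, ContDiff ℝ (⊤ : ℕ∞) γ ∧ (∀ t, γ (t + 1) = γ t) ∧
    (∀ t, deriv γ t ≠ 0) ∧ InjOn γ (Ico 0 1) ∧ range γ = frontier Ω

open scoped Topology Convolution

/-- The point of the Euclidean plane with given coordinates. -/
def planePoint (p : ℝ × ℝ) : E2 := !₂[p.1, p.2]

/-- Pairs of coordinates and points of the plane, as a measurable equivalence. -/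
def planeEquiv : ℝ × ℝ ≃ᵐ E2 :=
  (MeasurableEquiv.finTwoArrow (α := ℝ)).symm.trans (MeasurableEquiv.toLp 2 (Fin 2 → ℝ))

theorem planeEquiv_apply (p : ℝ × ℝ) : planeEquiv p = planePoint p := by
  ext i
  fin_cases i <;> rfl

theorem measurePreserving_planeEquiv : MeasurePreserving planeEquiv :=
  (EuclideanSpace.volume_preserving_symm_measurableEquiv_toLp (Fin 2)).symm.comp
    (volume_preserving_finTwoArrow ℝ).symm

/-- Coordinates of the exterior of a planar set by boundary parameter and normal distance. -/
structure NormalChart (Ω : Set E2) (γ N T : ℝ → E2) (ℓ k : ℝ → ℝ) : Prop where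
  hasDerivAt_curve : ∀ s, HasDerivAt γ (ℓ s • T s) s
  hasDerivAt_normal : ∀ s, HasDerivAt N (k s • T s) s
  continuous_speed : Continuous ℓ
  continuous_turning : Continuous k
  speed_pos : ∀ s, 0 < ℓ s
  turning_nonneg : ∀ s, 0 ≤ k s
  norm_normal : ∀ s, ‖N s‖ = 1
  norm_tangent : ∀ s, ‖T s‖ = 1
  abs_det : ∀ s, |T s 0 * N s 1 - N s 0 * T s 1| = 1
  support : ∀ s, ∀ y ∈ closure Ω, inner ℝ (N s) (y - γ s) ≤ 0
  injOn : InjOn γ (Ico 0 1)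
  image_eq : γ '' Ico 0 1 = frontier Ω
  exists_eq : ∀ x ∈ extDom Ω, ∃ s ∈ Ico (0 : ℝ) 1, ∃ t : ℝ, 0 < t ∧ x = γ s + t • N s

namespace NormalChart

variable {Ω : Set E2} {γ N T : ℝ → E2} {ℓ k : ℝ → ℝ}

theorem continuous_curve (h : NormalChart Ω γ N T ℓ k) : Continuous γ :=
  continuous_iff_continuousAt.2 fun s => (h.hasDerivAt_curve s).continuousAt

theorem curve_mem_frontier (h : NormalChart Ω γ N T ℓ k) {s : ℝ} (hs : s ∈ Ico (0 : ℝ) 1) :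
    γ s ∈ frontier Ω := h.image_eq ▸ mem_image_of_mem _ hs

theorem norm_sub_ge (h : NormalChart Ω γ N T ℓ k) (s : ℝ) {t : ℝ} (y : E2) (hy : y ∈ closure Ω) :
    t ^ 2 + ‖y - γ s‖ ^ 2 ≤ ‖γ s + t • N s - y‖ ^ 2 ∨ t < 0 := by
  rcases lt_or_ge t 0 with ht | ht
  · exact Or.inr ht
  left
  have e : γ s + t • N s - y = t • N s - (y - γ s) := by abel
  rw [e, norm_sub_sq_real (t • N s), norm_smul, h.norm_normal, inner_smul_left]
  have := mul_nonpos_of_nonneg_of_nonpos ht (h.support s y hy)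
  simp only [norm_eq_abs, mul_one, sq_abs, conj_trivial]
  linarith

theorem infDist_eq (h : NormalChart Ω γ N T ℓ k) {s t : ℝ} (hs : s ∈ Ico (0 : ℝ) 1)
    (ht : 0 ≤ t) : infDist (γ s + t • N s) Ω = t := by
  have hm : γ s ∈ closure Ω := frontier_subset_closure (h.curve_mem_frontier hs)
  rw [← infDist_closure]
  apply le_antisymm
  · refine (infDist_le_dist_of_mem hm).trans ?_
    simp [norm_smul, h.norm_normal, abs_of_nonneg ht]
  · rw [le_infDist ⟨_, hm⟩]
    intro y hy
    rw [dist_eq_norm]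
    refine le_of_sq_le_sq ?_ (norm_nonneg _)
    have := (h.norm_sub_ge s y hy (t := t)).resolve_right ht.not_gt
    nlinarith [sq_nonneg ‖y - γ s‖]

theorem mem_extDom (h : NormalChart Ω γ N T ℓ k) {s t : ℝ} (hs : s ∈ Ico (0 : ℝ) 1)
    (ht : 0 < t) : γ s + t • N s ∈ extDom Ω := by
  intro hc
  have := h.infDist_eq hs ht.le
  have h0 := infDist_zero_of_mem_closure hc
  linarith

/-- Normal coordinates, valued in coordinate pairs. -/
def coords (γ N : ℝ → E2) (p : ℝ × ℝ) : ℝ × ℝ :=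
  planeEquiv.symm (γ p.1 + p.2 • N p.1)

theorem planeEquiv_coords (p : ℝ × ℝ) : planeEquiv (coords γ N p) = γ p.1 + p.2 • N p.1 := by
  simp [coords]

theorem injOn_coords (h : NormalChart Ω γ N T ℓ k) : InjOn (coords γ N) (Ico 0 1 ×ˢ Ioi 0) := by
  rintro ⟨s, t⟩ ⟨hs, ht⟩ ⟨s', t'⟩ ⟨hs', ht'⟩ heq
  simp only [mem_Ioi] at hs ht hs' ht'
  have e : γ s + t • N s = γ s' + t' • N s' := planeEquiv.symm.injective heq
  have d := h.infDist_eq hs ht.le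
  rw [e, h.infDist_eq hs' ht'.le] at d
  subst d
  have b := (h.norm_sub_ge s (t := t') (γ s')
    (frontier_subset_closure (h.curve_mem_frontier hs'))).resolve_right ht'.le.not_gt
  rw [e, add_sub_cancel_left, norm_smul, h.norm_normal, mul_one, norm_eq_abs, sq_abs] at b
  have : ‖γ s' - γ s‖ = 0 := by
    have := sq_nonneg ‖γ s' - γ s‖
    exact pow_eq_zero_iff (two_ne_zero) |>.1 (le_antisymm (by linarith) this)
  have := h.injOn hs' hs (sub_eq_zero.1 (norm_eq_zero.1 this))
  simp [this]

theorem image_coords (h : NormalChart Ω γ N T ℓ k) :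
    coords γ N '' (Ico 0 1 ×ˢ Ioi 0) = planeEquiv ⁻¹' extDom Ω := by
  ext q
  constructor
  · rintro ⟨⟨s, t⟩, ⟨hs, ht⟩, rfl⟩
    rw [mem_preimage, planeEquiv_coords]
    exact h.mem_extDom hs ht
  · intro hq
    obtain ⟨s, hs, t, ht, e⟩ := h.exists_eq _ hq
    exact ⟨(s, t), ⟨hs, ht⟩, by rw [coords, ← e, MeasurableEquiv.symm_apply_apply]⟩

/-- The derivative of normal coordinates. -/
def coordsDeriv (N T : ℝ → E2) (ℓ k : ℝ → ℝ) (p : ℝ × ℝ) : ℝ × ℝ →L[ℝ] ℝ × ℝ :=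
  (Matrix.toLin (.finTwoProd ℝ) (.finTwoProd ℝ)
    !![(ℓ p.1 + p.2 * k p.1) * T p.1 0, N p.1 0;
       (ℓ p.1 + p.2 * k p.1) * T p.1 1, N p.1 1]).toContinuousLinearMap

theorem hasFDerivAt_coords (h : NormalChart Ω γ N T ℓ k) (p : ℝ × ℝ) :
    HasFDerivAt (coords γ N) (coordsDeriv N T ℓ k p) p := by
  have key : ∀ i : Fin 2, HasFDerivAt (fun p : ℝ × ℝ => (γ p.1 + p.2 • N p.1) i)
      (((ℓ p.1 + p.2 * k p.1) * T p.1 i) • ContinuousLinearMap.fst ℝ ℝ ℝ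
        + (N p.1 i) • ContinuousLinearMap.snd ℝ ℝ ℝ) p := by
    intro i
    have h1 : HasDerivAt (fun s => γ s i) (ℓ p.1 * T p.1 i) p.1 :=
      (EuclideanSpace.proj (𝕜 := ℝ) i).hasFDerivAt.comp_hasDerivAt p.1 (h.hasDerivAt_curve p.1)
    have h2 : HasDerivAt (fun s => N s i) (k p.1 * T p.1 i) p.1 :=
      (EuclideanSpace.proj (𝕜 := ℝ) i).hasFDerivAt.comp_hasDerivAt p.1 (h.hasDerivAt_normal p.1)
    have h3 := (h1.comp_hasFDerivAt p hasFDerivAt_fst).add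
      ((hasFDerivAt_snd (𝕜 := ℝ) (p := p)).mul (h2.comp_hasFDerivAt p hasFDerivAt_fst))
    refine HasFDerivAt.congr_fderiv h3 ?_
    ext <;> simp <;> ring
  rw [coordsDeriv, Matrix.toLin_finTwoProd_toContinuousLinearMap]
  exact (key 0).prodMk (key 1)

theorem abs_det_coordsDeriv (h : NormalChart Ω γ N T ℓ k) {p : ℝ × ℝ} (hp : 0 < p.2) :
    |(coordsDeriv N T ℓ k p).det| = ℓ p.1 + p.2 * k p.1 := by
  have hpos : 0 ≤ ℓ p.1 + p.2 * k p.1 := by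
    have := h.speed_pos p.1
    have := h.turning_nonneg p.1
    positivity
  simp only [coordsDeriv, LinearMap.det_toContinuousLinearMap, LinearMap.det_toLin,
    Matrix.det_fin_two_of]
  rw [show (ℓ p.1 + p.2 * k p.1) * T p.1 0 * N p.1 1
    - N p.1 0 * ((ℓ p.1 + p.2 * k p.1) * T p.1 1)
    = (ℓ p.1 + p.2 * k p.1) * (T p.1 0 * N p.1 1 - N p.1 0 * T p.1 1) by ring, abs_mul,
    h.abs_det, mul_one, abs_of_nonneg hpos]

theorem integrableOn_iff (h : NormalChart Ω γ N T ℓ k) (F : E2 → ℝ) :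
    IntegrableOn F (extDom Ω) ↔ IntegrableOn
      (fun p : ℝ × ℝ => (ℓ p.1 + p.2 * k p.1) * F (γ p.1 + p.2 • N p.1))
      (Ico 0 1 ×ˢ Ioi 0) := by
  have hm : MeasurableSet (Ico (0 : ℝ) 1 ×ˢ Ioi (0 : ℝ)) :=
    measurableSet_Ico.prod measurableSet_Ioi
  rw [← measurePreserving_planeEquiv.integrableOn_comp_preimage planeEquiv.measurableEmbedding,
    ← h.image_coords, integrableOn_image_iff_integrableOn_abs_det_fderiv_smul volume hm
    (fun p _ => (h.hasFDerivAt_coords p).hasFDerivWithinAt) h.injOn_coords]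
  refine integrableOn_congr_fun (fun p hp => ?_) hm
  simp only [Function.comp, h.abs_det_coordsDeriv hp.2, planeEquiv_coords, smul_eq_mul]

theorem integral_eq (h : NormalChart Ω γ N T ℓ k) (F : E2 → ℝ) :
    ∫ x in extDom Ω, F x = ∫ p in Ico (0 : ℝ) 1 ×ˢ Ioi (0 : ℝ),
      (ℓ p.1 + p.2 * k p.1) * F (γ p.1 + p.2 • N p.1) := by
  have hm : MeasurableSet (Ico (0 : ℝ) 1 ×ˢ Ioi (0 : ℝ)) :=
    measurableSet_Ico.prod measurableSet_Ioi
  rw [← measurePreserving_planeEquiv.setIntegral_preimage_emb planeEquiv.measurableEmbedding,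
    ← h.image_coords, integral_image_eq_integral_abs_det_fderiv_smul volume hm
    (fun p _ => (h.hasFDerivAt_coords p).hasFDerivWithinAt) h.injOn_coords]
  refine setIntegral_congr_fun hm (fun p hp => ?_)
  simp only [h.abs_det_coordsDeriv hp.2, planeEquiv_coords, smul_eq_mul]

theorem integral_eq_iterated (h : NormalChart Ω γ N T ℓ k) {F : E2 → ℝ}
    (hF : IntegrableOn F (extDom Ω)) :
    ∫ x in extDom Ω, F x = ∫ s in Ico (0 : ℝ) 1, ∫ t in Ioi (0 : ℝ),
      (ℓ s + t * k s) * F (γ s + t • N s) := by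
  rw [h.integral_eq]
  exact setIntegral_prod _ ((h.integrableOn_iff F).1 hF)

theorem integral_comp_infDist (h : NormalChart Ω γ N T ℓ k) {f : ℝ → ℝ}
    (hf : IntegrableOn (fun x => f (infDist x Ω)) (extDom Ω)) :
    ∫ x in extDom Ω, f (infDist x Ω) = ∫ t in Ioi (0 : ℝ),
      ((∫ s in Ico (0 : ℝ) 1, ℓ s) + t * ∫ s in Ico (0 : ℝ) 1, k s) * f t := by
  have hm : MeasurableSet (Ico (0 : ℝ) 1 ×ˢ Ioi (0 : ℝ)) :=
    measurableSet_Ico.prod measurableSet_Ioi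
  have hF := (h.integrableOn_iff _).1 hf
  have hG : IntegrableOn (fun p : ℝ × ℝ => (ℓ p.1 + p.2 * k p.1) * f p.2)
      (Ico 0 1 ×ˢ Ioi 0) := by
    refine hF.congr_fun (fun p hp => ?_) hm
    simp only [h.infDist_eq hp.1 (le_of_lt hp.2)]
  rw [h.integral_eq, setIntegral_congr_fun (g := fun p : ℝ × ℝ => (ℓ p.1 + p.2 * k p.1) * f p.2) hm
    (fun p hp => by simp only [h.infDist_eq hp.1 (le_of_lt hp.2)])]
  have hi : ∀ g : ℝ → ℝ, Continuous g → IntegrableOn g (Ico 0 1) := fun g hg =>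
    (hg.integrableOn_Icc (a := 0) (b := 1)).mono_set Ico_subset_Icc_self
  rw [IntegrableOn, Measure.volume_eq_prod, ← Measure.prod_restrict] at hG
  rw [Measure.volume_eq_prod, ← Measure.prod_restrict, integral_prod_symm _ hG]
  refine integral_congr_ae (Eventually.of_forall fun t => ?_)
  simp only
  rw [integral_mul_const, integral_add (hi _ h.continuous_speed)
    ((hi _ h.continuous_turning).const_mul t), integral_const_mul]

end NormalChart

section BrunnMinkowski

open scoped Pointwise ENNReal

theorem volume_add_volume_le_of_isCompact {K L C : Set ℝ} (hK : IsCompact K) (hL : IsCompact L)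
    (hK0 : K.Nonempty) (hL0 : L.Nonempty) (h : ∀ a ∈ K, ∀ b ∈ L, a + b ∈ C) :
    volume K + volume L ≤ volume C := by
  have hx := hK.sSup_mem hK0
  have hy := hL.sInf_mem hL0
  set x := sSup K
  set y := sInf L
  have h1 : volume K = volume ((fun a => a + y) '' (K \ {x})) := by
    rw [image_add_right, measure_preimage_add_right, measure_sdiff_null (by simp)]
  have h2 : volume L = volume ((fun b => x + b) '' L) := by
    rw [image_add_left, measure_preimage_add]
  have hm : MeasurableSet ((fun b => x + b) '' L) :=
    (hL.image (continuous_const.add continuous_id)).measurableSet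
  rw [h1, h2, ← measure_union _ hm]
  · refine measure_mono (union_subset ?_ ?_)
    · rintro _ ⟨a, ha, rfl⟩
      exact h a ha.1 y hy
    · rintro _ ⟨b, hb, rfl⟩
      exact h x hx b hb
  · rw [Set.disjoint_left]
    rintro _ ⟨a, ⟨ha, hne⟩, rfl⟩ ⟨b, hb, e⟩
    have ha' : a < x := lt_of_le_of_ne (le_csSup hK.bddAbove ha) hne
    have hb' : y ≤ b := csInf_le hL.bddBelow hb
    simp only at e
    linarith

theorem volume_add_volume_le {A B C : Set ℝ} (hA : MeasurableSet A) (hB : MeasurableSet B)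
    (hA0 : A.Nonempty) (hB0 : B.Nonempty) (h : ∀ a ∈ A, ∀ b ∈ B, a + b ∈ C) :
    volume A + volume B ≤ volume C := by
  obtain ⟨a, ha⟩ := hA0
  obtain ⟨b, hb⟩ := hB0
  have hl : volume B ≤ volume C := by
    rw [← measure_preimage_add volume (-a) B]
    refine measure_mono fun c hc => ?_
    simpa using h a ha _ hc
  have hr : volume A ≤ volume C := by
    rw [← measure_preimage_add volume (-b) A]
    refine measure_mono fun c hc => ?_
    have := h _ hc b hb
    simpa using this
  rw [hA.measure_eq_iSup_isCompact, hB.measure_eq_iSup_isCompact]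
  simp only [iSup_and']
  refine ENNReal.biSup_add_biSup_le' ⟨∅, empty_subset _, isCompact_empty⟩
    ⟨∅, empty_subset _, isCompact_empty⟩ ?_
  rintro K ⟨hKA, hK⟩ L ⟨hLB, hL⟩
  rcases K.eq_empty_or_nonempty with rfl | hK0
  · simpa using (measure_mono hLB).trans hl
  rcases L.eq_empty_or_nonempty with rfl | hL0
  · simpa using (measure_mono hKA).trans hr
  exact volume_add_volume_le_of_isCompact hK hL hK0 hL0 fun a ha b hb => h a (hKA ha) b (hLB hb)

/-- The length of the vertical slice of a planar set. -/
def sliceLength (A : Set (ℝ × ℝ)) (x : ℝ) : ℝ := volume.real (Prod.mk x ⁻¹' A)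

theorem sliceLength_nonneg (A : Set (ℝ × ℝ)) (x : ℝ) : 0 ≤ sliceLength A x := measureReal_nonneg

theorem measurable_sliceLength {A : Set (ℝ × ℝ)} (hA : MeasurableSet A) :
    Measurable (sliceLength A) :=
  (measurable_measure_prodMk_left hA).ennreal_toReal

theorem exists_volume_slice_le {A : Set (ℝ × ℝ)} (hA : IsBounded A) :
    ∃ c : ℝ, 0 ≤ c ∧ ∀ x, volume (Prod.mk x ⁻¹' A) ≤ ENNReal.ofReal c := by
  obtain ⟨r, hr0, hr⟩ := hA.subset_closedBall_lt 0 0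
  refine ⟨2 * r, by positivity, fun x => ?_⟩
  rw [← Real.volume_closedBall (0 : ℝ) r]
  refine measure_mono fun y hy => ?_
  have := hr hy
  rw [mem_closedBall, dist_zero_right, Prod.norm_def] at this
  simpa using (le_max_right _ _).trans this

theorem lintegral_sliceLength {A : Set (ℝ × ℝ)} (hA : MeasurableSet A) (hb : IsBounded A) :
    ∫⁻ x, ENNReal.ofReal (sliceLength A x) = volume A := by
  obtain ⟨c, -, hc⟩ := exists_volume_slice_le hb
  rw [Measure.volume_eq_prod, Measure.prod_apply hA]
  refine lintegral_congr fun x => ENNReal.ofReal_toReal ?_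
  exact ne_top_of_le_ne_top ENNReal.ofReal_ne_top (hc x)

theorem bddAbove_sliceLength {A : Set (ℝ × ℝ)} (hb : IsBounded A) :
    BddAbove (range (sliceLength A)) := by
  obtain ⟨c, h0, hc⟩ := exists_volume_slice_le hb
  refine ⟨c, ?_⟩
  rintro _ ⟨x, rfl⟩
  exact ENNReal.toReal_le_of_le_ofReal h0 (hc x)

theorem volume_div_eq_lintegral {A : Set (ℝ × ℝ)} (hA : MeasurableSet A) (hb : IsBounded A)
    {M : ℝ} (hM : 0 < M) :
    volume A / ENNReal.ofReal M = ∫⁻ t in Ioi (0 : ℝ), volume {x | t < sliceLength A x / M} := by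
  rw [← lintegral_eq_lintegral_meas_lt volume
    (Eventually.of_forall fun x => div_nonneg (sliceLength_nonneg A x) hM.le)
    ((measurable_sliceLength hA).div_const M).aemeasurable, ← lintegral_sliceLength hA hb]
  simp_rw [ENNReal.ofReal_div_of_pos hM, div_eq_mul_inv]
  rw [lintegral_mul_const _ (measurable_sliceLength hA).ennreal_ofReal]

theorem iSup_sliceLength_pos {A : Set (ℝ × ℝ)} (hA : MeasurableSet A) (hb : IsBounded A)
    (h0 : 0 < volume A) : 0 < ⨆ x, sliceLength A x := by
  by_contra hcon
  have : ∀ x, sliceLength A x = 0 := fun x =>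
    le_antisymm ((le_ciSup (bddAbove_sliceLength hb) x).trans (not_lt.1 hcon))
      (sliceLength_nonneg A x)
  rw [← lintegral_sliceLength hA hb] at h0
  simp [this] at h0

theorem volume_div_iSup_le {A : Set (ℝ × ℝ)} (hA : MeasurableSet A) (hb : IsBounded A)
    (h0 : 0 < volume A) :
    volume A / ENNReal.ofReal (⨆ x, sliceLength A x) ≤
      ∫⁻ t in Ioo (0 : ℝ) 1, volume {x | t < sliceLength A x / ⨆ x, sliceLength A x} := by
  have hM := iSup_sliceLength_pos hA hb h0
  rw [volume_div_eq_lintegral hA hb hM, ← Ioo_union_Ici_eq_Ioi zero_lt_one]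
  refine (lintegral_union_le _ _ _).trans_eq ?_
  rw [setLIntegral_congr_fun (g := fun _ => 0) measurableSet_Ici]
  · simp
  · intro t ht
    simp only
    convert measure_empty (μ := (volume : Measure ℝ))
    rw [eq_empty_iff_forall_notMem]
    intro x hx
    rw [mem_ofPred_eq, lt_div_iff₀ hM] at hx
    have := le_ciSup (bddAbove_sliceLength hb) x
    rw [mem_Ici] at ht
    nlinarith

/-- The Brunn–Minkowski inequality for bounded measurable planar sets. -/
theorem sqrt_volume_add_sqrt_volume_le {A B C : Set (ℝ × ℝ)} (hA : MeasurableSet A)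
    (hB : MeasurableSet B) (hC : MeasurableSet C) (hbA : IsBounded A) (hbB : IsBounded B)
    (hbC : IsBounded C) (hA0 : 0 < volume A) (hB0 : 0 < volume B)
    (h : ∀ a ∈ A, ∀ b ∈ B, a + b ∈ C) :
    √(volume.real A) + √(volume.real B) ≤ √(volume.real C) := by
  have hm := iSup_sliceLength_pos hA hbA hA0
  have hn := iSup_sliceLength_pos hB hbB hB0
  have hmA := volume_div_iSup_le hA hbA hA0
  have hnB := volume_div_iSup_le hB hbB hB0
  have hlt : ∀ {D : Set (ℝ × ℝ)} {t : ℝ}, 0 < (⨆ x, sliceLength D x) → t < 1 →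
      {x | t < sliceLength D x / ⨆ x, sliceLength D x}.Nonempty := by
    intro D t hD ht
    obtain ⟨x, hx⟩ := exists_lt_of_lt_ciSup
      (show t * (⨆ x, sliceLength D x) < ⨆ x, sliceLength D x by nlinarith)
    exact ⟨x, (lt_div_iff₀ hD).2 hx⟩
  set m := ⨆ x, sliceLength A x
  set n := ⨆ x, sliceLength B x
  obtain ⟨c, hc0, hc⟩ := exists_volume_slice_le hbC
  have key : volume A / ENNReal.ofReal m + volume B / ENNReal.ofReal n
      ≤ volume C / ENNReal.ofReal (m + n) := by
    rw [volume_div_eq_lintegral hC hbC (add_pos hm hn)]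
    refine (add_le_add hmA hnB).trans ?_
    rw [← lintegral_add_left]
    · refine le_trans ?_ (lintegral_mono_set (Ioo_subset_Ioi_self : Ioo (0 : ℝ) 1 ⊆ Ioi 0))
      refine setLIntegral_mono' measurableSet_Ioo fun t ht => ?_
      have meas : ∀ {D : Set (ℝ × ℝ)} {r : ℝ}, MeasurableSet D →
          MeasurableSet {x | t < sliceLength D x / r} := fun hD =>
        measurableSet_lt measurable_const ((measurable_sliceLength hD).div_const _)
      refine volume_add_volume_le (meas hA) (meas hB) (hlt hm ht.2) (hlt hn ht.2) ?_
      intro x hx y hy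
      rw [mem_ofPred_eq, lt_div_iff₀ hm] at hx
      rw [mem_ofPred_eq, lt_div_iff₀ hn] at hy
      rw [mem_ofPred_eq, lt_div_iff₀ (add_pos hm hn)]
      have posx : 0 < sliceLength A x := lt_of_le_of_lt (mul_nonneg ht.1.le hm.le) hx
      have posy : 0 < sliceLength B y := lt_of_le_of_lt (mul_nonneg ht.1.le hn.le) hy
      have hle := volume_add_volume_le (measurable_prodMk_left (x := x) hA)
        (measurable_prodMk_left (x := y) hB)
        (nonempty_of_measure_ne_zero (μ := volume) fun e => posx.ne' (by simp [sliceLength, Measure.real, e]))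
        (nonempty_of_measure_ne_zero (μ := volume) fun e => posy.ne' (by simp [sliceLength, Measure.real, e]))
        (C := Prod.mk (x + y) ⁻¹' C) (fun a ha b hb => h _ ha _ hb)
      have htop : volume (Prod.mk (x + y) ⁻¹' C) ≠ ∞ :=
        ne_top_of_le_ne_top ENNReal.ofReal_ne_top (hc _)
      have := ENNReal.toReal_mono htop hle
      rw [ENNReal.toReal_add (ne_top_of_le_ne_top htop (le_self_add.trans hle))
        (ne_top_of_le_ne_top htop (le_add_self.trans hle))] at this
      change sliceLength A x + sliceLength B y ≤ sliceLength C (x + y) at this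
      linarith
    · refine Antitone.measurable fun s t hst => measure_mono fun x hx => lt_of_le_of_lt hst hx
  have ha : volume A ≠ ∞ := hbA.measure_lt_top.ne
  have hb : volume B ≠ ∞ := hbB.measure_lt_top.ne
  have hcC : volume C ≠ ∞ := hbC.measure_lt_top.ne
  have key' : volume.real A / m + volume.real B / n ≤ volume.real C / (m + n) := by
    have := ENNReal.toReal_mono (ENNReal.div_ne_top hcC (by simp; linarith)) key
    rw [ENNReal.toReal_add (ENNReal.div_ne_top ha (by simpa using hm))
      (ENNReal.div_ne_top hb (by simpa using hn))] at this
    simpa [ENNReal.toReal_div, hm.le, hn.le, add_nonneg, Measure.real] using this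
  set a := volume.real A
  set b := volume.real B
  have ha0 : 0 ≤ a := measureReal_nonneg
  have hb0 : 0 ≤ b := measureReal_nonneg
  rw [le_div_iff₀ (add_pos hm hn)] at key'
  refine Real.le_sqrt_of_sq_le (le_trans ?_ key')
  have e : (a / m + b / n) * (m + n) - (√a + √b) ^ 2 = (n * √a - m * √b) ^ 2 / (m * n) := by
    have h1 := Real.sq_sqrt ha0
    have h2 := Real.sq_sqrt hb0
    field_simp
    ring_nf
    rw [h1, h2]
    ring
  have : 0 ≤ (n * √a - m * √b) ^ 2 / (m * n) := by positivity
  linarith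

end BrunnMinkowski

namespace NormalChart

variable {Ω : Set E2} {γ N T : ℝ → E2} {ℓ k : ℝ → ℝ}

theorem length_pos (h : NormalChart Ω γ N T ℓ k) : 0 < ∫ s in Ico (0 : ℝ) 1, ℓ s := by
  rw [integral_Ico_eq_integral_Ioo, ← integral_Ioc_eq_integral_Ioo,
    ← intervalIntegral.integral_of_le zero_le_one]
  exact intervalIntegral.intervalIntegral_pos_of_pos
    (h.continuous_speed.intervalIntegrable 0 1) h.speed_pos zero_lt_one

theorem turning_integral_nonneg (h : NormalChart Ω γ N T ℓ k) :
    0 ≤ ∫ s in Ico (0 : ℝ) 1, k s :=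
  integral_nonneg h.turning_nonneg

theorem isBounded_infDist_lt (hne : Ω.Nonempty) (hb : IsBounded Ω) (r : ℝ) :
    IsBounded {x : E2 | infDist x Ω < r} := by
  obtain ⟨o, ho⟩ := hne
  obtain ⟨d, hd⟩ := hb.subset_ball o
  refine isBounded_ball (x := o) (r := r + d) |>.subset fun x hx => ?_
  obtain ⟨y, hy, hxy⟩ := (infDist_lt_iff ⟨o, ho⟩).1 hx
  have := mem_ball.1 (hd hy)
  exact mem_ball.2 ((dist_triangle x y o).trans_lt (by linarith))

theorem measurableSet_infDist_lt (r : ℝ) : MeasurableSet {x : E2 | infDist x Ω < r} :=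
  (isOpen_lt (continuous_infDist_pt Ω) continuous_const).measurableSet

theorem volume_real_shell (h : NormalChart Ω γ N T ℓ k) (hne : Ω.Nonempty) (hb : IsBounded Ω)
    {r : ℝ} (hr : 0 < r) :
    volume.real ({x | infDist x Ω < r} ∩ extDom Ω) =
      (∫ s in Ico (0 : ℝ) 1, ℓ s) * r + (∫ s in Ico (0 : ℝ) 1, k s) * r ^ 2 / 2 := by
  have hms := measurableSet_infDist_lt (Ω := Ω) r
  have e : (fun x => (Iio r).indicator (fun _ => (1 : ℝ)) (infDist x Ω))
      = {x | infDist x Ω < r}.indicator fun _ => 1 := by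
    ext x
    simp [indicator]
  have hint : IntegrableOn (fun x => (Iio r).indicator (fun _ => (1 : ℝ)) (infDist x Ω))
      (extDom Ω) := by
    rw [e]
    refine Integrable.integrableOn ?_
    rw [integrable_indicator_iff hms]
    exact integrableOn_const (isBounded_infDist_lt hne hb r).measure_lt_top.ne
  have key := h.integral_comp_infDist hint
  rw [e, setIntegral_indicator hms, setIntegral_const, smul_eq_mul, mul_one, inter_comm] at key
  rw [key]
  set L := ∫ s in Ico (0 : ℝ) 1, ℓ s
  set C := ∫ s in Ico (0 : ℝ) 1, k s
  have e2 : (fun t => (L + t * C) * (Iio r).indicator (fun _ => (1 : ℝ)) t)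
      = (Iio r).indicator fun t => L + t * C := by
    ext t
    simp [indicator]
  rw [e2, setIntegral_indicator measurableSet_Iio, Ioi_inter_Iio, ← integral_Ioc_eq_integral_Ioo,
    ← intervalIntegral.integral_of_le hr.le, intervalIntegral.integral_add (by simp)
    (Continuous.intervalIntegrable (by fun_prop) _ _),
    intervalIntegral.integral_mul_const, integral_id]
  simp
  ring

theorem turning_integral_le (h : NormalChart Ω γ N T ℓ k) (hne : Ω.Nonempty) (hb : IsBounded Ω) :
    ∫ s in Ico (0 : ℝ) 1, k s ≤ 2 * π := by
  obtain ⟨o, ho⟩ := id hne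
  obtain ⟨d, hd0, hd⟩ := hb.subset_ball_lt 0 o
  have key : ∀ r, 0 < r → (∫ s in Ico (0 : ℝ) 1, ℓ s) * r + (∫ s in Ico (0 : ℝ) 1, k s) * r ^ 2 / 2
      ≤ π * (r + d) ^ 2 := by
    intro r hr
    rw [← h.volume_real_shell hne hb hr]
    have hball : volume.real (ball o (r + d)) = π * (r + d) ^ 2 := by
      rw [Measure.real, EuclideanSpace.volume_ball_fin_two]
      have : 0 ≤ r + d := by positivity
      simp [this, pi_pos.le, mul_comm]
    rw [← hball]
    refine measureReal_mono (fun x hx => ?_) measure_ball_lt_top.ne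
    obtain ⟨y, hy, hxy⟩ := (infDist_lt_iff ⟨o, ho⟩).1 hx.1
    have := mem_ball.1 (hd hy)
    exact mem_ball.2 ((dist_triangle x y o).trans_lt (by linarith))
  have hL := h.length_pos
  set L := ∫ s in Ico (0 : ℝ) 1, ℓ s
  set C := ∫ s in Ico (0 : ℝ) 1, k s
  by_contra! hC
  obtain ⟨δ, hδ⟩ : ∃ δ, δ = C / 2 - π := ⟨_, rfl⟩
  have hδ0 : 0 < δ := by linarith
  have hpi := pi_pos
  have hr := key (1 + (2 * π * d + π * d ^ 2) / δ) (by positivity)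
  obtain ⟨r, hrd⟩ : ∃ r, r = 1 + (2 * π * d + π * d ^ 2) / δ := ⟨_, rfl⟩
  have e : δ * r = δ + (2 * π * d + π * d ^ 2) := by rw [hrd]; field_simp
  have hr1 : 1 ≤ r := by
    rw [hrd]
    have : 0 ≤ (2 * π * d + π * d ^ 2) / δ := by positivity
    linarith
  rw [← hrd] at hr
  have hC' : C = 2 * δ + 2 * π := by linarith
  rw [hC'] at hr
  have e2 : δ * r ^ 2 = (δ + (2 * π * d + π * d ^ 2)) * r := by rw [← e]; ring
  have h3 : 0 < L * r := by positivity
  have h4 : 0 < δ * r := by positivity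
  have h5 : π * d ^ 2 * 1 ≤ π * d ^ 2 * r := by gcongr
  nlinarith

theorem isBounded_preimage_planeEquiv {A : Set E2} (hA : IsBounded A) :
    IsBounded (planeEquiv ⁻¹' A) := by
  obtain ⟨c, hc⟩ := hA.exists_norm_le
  refine isBounded_iff_forall_norm_le.2 ⟨c, fun p hp => ?_⟩
  have := hc _ hp
  rw [planeEquiv_apply] at this
  have h0 := PiLp.norm_apply_le (planePoint p) 0
  have h1 := PiLp.norm_apply_le (planePoint p) 1
  exact max_le (h0.trans this) (h1.trans this)

theorem planeEquiv_add (p q : ℝ × ℝ) : planeEquiv (p + q) = planeEquiv p + planeEquiv q := by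
  simp only [planeEquiv_apply]
  ext i
  fin_cases i <;> rfl

/-- The isoperimetric inequality. -/
theorem isoperimetric (h : NormalChart Ω γ N T ℓ k) (hne : Ω.Nonempty) (ho : IsOpen Ω)
    (hb : IsBounded Ω) (hconv : Convex ℝ Ω) {c : E2} {R : ℝ} (hR : 0 < R)
    (harea : volume (ball c R) = volume Ω) : 2 * π * R ≤ ∫ s in Ico (0 : ℝ) 1, ℓ s := by
  have hball : ∀ (x : E2) {r : ℝ}, 0 < r → volume.real (ball x r) = π * r ^ 2 := by
    intro x r hr
    rw [Measure.real, EuclideanSpace.volume_ball_fin_two]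
    simp [hr.le, pi_pos.le, mul_comm]
  have hpre : ∀ A : Set E2, volume (planeEquiv ⁻¹' A) = volume A := fun A =>
    measurePreserving_planeEquiv.measure_preimage_equiv A
  have hC := h.turning_integral_le hne hb
  have hBM : √(volume.real Ω) + √(volume.real (ball (0 : E2) R)) ≤
      √(volume.real {x : E2 | infDist x Ω < R}) := by
    have := sqrt_volume_add_sqrt_volume_le (planeEquiv.measurable ho.measurableSet)
      (planeEquiv.measurable (measurableSet_ball (x := (0 : E2)) (ε := R)))
      (planeEquiv.measurable (measurableSet_infDist_lt (Ω := Ω) R))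
      (isBounded_preimage_planeEquiv hb) (isBounded_preimage_planeEquiv isBounded_ball)
      (isBounded_preimage_planeEquiv (isBounded_infDist_lt hne hb R))
      (by rw [hpre]; exact ho.measure_pos _ hne)
      (by rw [hpre]; exact measure_ball_pos _ _ hR)
      (by
        intro a ha b hb
        rw [mem_preimage, planeEquiv_add, mem_ofPred_eq]
        refine (infDist_le_dist_of_mem (mem_preimage.1 ha)).trans_lt ?_
        simpa using hb)
    simpa only [Measure.real, hpre] using this
  have hA : volume.real Ω = π * R ^ 2 := by rw [Measure.real, ← harea, ← hball c hR, Measure.real]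
  rw [hA, hball 0 hR] at hBM
  have hsplit : volume.real {x : E2 | infDist x Ω < R} ≤ π * R ^ 2 +
      volume.real ({x | infDist x Ω < R} ∩ extDom Ω) := by
    have hcl : volume.real (closure Ω) = π * R ^ 2 := by
      rw [← hA]
      refine measureReal_congr ?_
      refine (closure_ae_eq_of_null_frontier ?_)
      exact hconv.addHaar_frontier volume
    rw [← hcl]
    refine (measureReal_mono (fun x hx => ?_) ?_).trans (measureReal_union_le _ _)
    · by_cases hx' : x ∈ closure Ω
      · exact Or.inl hx'
      · exact Or.inr ⟨hx, hx'⟩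
    · exact (hb.closure.union ((isBounded_infDist_lt hne hb R).subset
        inter_subset_left)).measure_lt_top.ne
  rw [h.volume_real_shell hne hb hR] at hsplit
  set L := ∫ s in Ico (0 : ℝ) 1, ℓ s
  set C := ∫ s in Ico (0 : ℝ) 1, k s
  have hsq := (sq_le_sq₀ (by positivity) (by positivity)).2 hBM
  rw [sq_sqrt measureReal_nonneg, ← two_mul, mul_pow, sq_sqrt (by positivity)] at hsq
  have h1 : C * R ^ 2 ≤ 2 * π * R ^ 2 := by gcongr
  have h2 : 2 * π * R * R ≤ L * R := by nlinarith
  exact le_of_mul_le_mul_right h2 hR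

end NormalChart

namespace NormalChart

variable {Ω : Set E2} {γ N T : ℝ → E2} {ℓ k : ℝ → ℝ}

theorem hausdorffMeasure_image_le (h : NormalChart Ω γ N T ℓ k) {Λ : NNReal}
    (hΛ : ∀ s ∈ Ico (0 : ℝ) 1, ℓ s ≤ Λ) {S : Set ℝ} (hS : S ⊆ Ico 0 1) :
    μH[1] (γ '' S) ≤ Λ * volume S := by
  have hlip : LipschitzOnWith Λ γ (Ico 0 1) := by
    refine (convex_Ico 0 1).lipschitzOnWith_of_nnnorm_hasDerivWithin_le
      (fun s _ => (h.hasDerivAt_curve s).hasDerivWithinAt) fun s hs => ?_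
    rw [← NNReal.coe_le_coe, coe_nnnorm, norm_smul, h.norm_tangent, mul_one, norm_eq_abs,
      abs_of_pos (h.speed_pos s)]
    exact hΛ s hs
  have := (hlip.mono hS).hausdorffMeasure_image_le zero_le_one
  simpa [hausdorffMeasure_real] using this

theorem exists_speed_le (h : NormalChart Ω γ N T ℓ k) :
    ∃ Λ : NNReal, ∀ s ∈ Ico (0 : ℝ) 1, ℓ s ≤ Λ := by
  obtain ⟨c, hc⟩ := (isCompact_Icc (a := (0 : ℝ)) (b := 1)).bddAbove_image
    h.continuous_speed.continuousOn
  exact ⟨c.toNNReal, fun s hs =>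
    (hc (mem_image_of_mem _ (Ico_subset_Icc_self hs))).trans (le_coe_toNNReal c)⟩

theorem hausdorffMeasure_frontier_lt_top (h : NormalChart Ω γ N T ℓ k) :
    μH[1] (frontier Ω) < ⊤ := by
  obtain ⟨Λ, hΛ⟩ := h.exists_speed_le
  rw [← h.image_eq]
  refine (h.hausdorffMeasure_image_le hΛ subset_rfl).trans_lt ?_
  simp

theorem integral_frontier_le (h : NormalChart Ω γ N T ℓ k) {Λ : NNReal}
    (hΛ : ∀ s ∈ Ico (0 : ℝ) 1, ℓ s ≤ Λ) {f : E2 → ℝ} (hf : Continuous f) (hf0 : ∀ x, 0 ≤ f x) :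
    ∫ x in frontier Ω, f x ∂(μH[1]) ≤ Λ * ∫ s in Ico (0 : ℝ) 1, f (γ s) := by
  have hle : (μH[1] : Measure E2).restrict (frontier Ω) ≤
      Λ • (volume.restrict (Ico (0 : ℝ) 1)).map γ := by
    refine Measure.le_iff.2 fun A hA => ?_
    rw [Measure.restrict_apply hA, Measure.smul_apply,
      Measure.map_apply h.continuous_curve.measurable hA,
      Measure.restrict_apply (h.continuous_curve.measurable hA)]
    have e : A ∩ frontier Ω = γ '' (γ ⁻¹' A ∩ Ico 0 1) := by
      rw [← h.image_eq, inter_comm, inter_comm (γ ⁻¹' A), image_inter_preimage]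
    rw [e]
    exact h.hausdorffMeasure_image_le hΛ inter_subset_right
  have hcont : IntegrableOn (fun s => f (γ s)) (Ico (0 : ℝ) 1) :=
    (hf.comp h.continuous_curve).integrableOn_Icc.mono_set Ico_subset_Icc_self
  have hint : Integrable f ((volume.restrict (Ico (0 : ℝ) 1)).map γ) := by
    rw [integrable_map_measure hf.aestronglyMeasurable h.continuous_curve.aemeasurable]
    exact hcont
  refine (integral_mono_measure hle (Eventually.of_forall hf0) (hint.smul_measure_nnreal)).trans_eq ?_
  rw [integral_smul_nnreal_measure, integral_map h.continuous_curve.aemeasurable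
    hf.aestronglyMeasurable]
  rfl

theorem edist_le_hausdorffMeasure_image {a b : ℝ} (hab : a ≤ b)
    {γ : ℝ → E2} (hγ : Continuous γ) : edist (γ a) (γ b) ≤ μH[1] (γ '' Ico a b) := by
  have hlip : LipschitzWith 1 fun x : E2 => dist x (γ a) := LipschitzWith.dist_left (γ a)
  have h1 := hlip.hausdorffMeasure_image_le zero_le_one (γ '' Ico a b)
  simp only [ENNReal.coe_one, ENNReal.one_rpow, one_mul, hausdorffMeasure_real] at h1
  refine le_trans ?_ h1
  have hsub : Ico 0 (dist (γ b) (γ a)) ⊆ (fun x => dist x (γ a)) '' (γ '' Ico a b) := by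
    rw [image_image]
    have := intermediate_value_Ico hab (f := fun s => dist (γ s) (γ a))
      (hγ.dist continuous_const).continuousOn
    simpa using this
  refine le_trans ?_ (measure_mono hsub)
  rw [Real.volume_Ico, sub_zero, edist_dist, dist_comm]

theorem length_le_hausdorffMeasure (h : NormalChart Ω γ N T ℓ k) :
    ∫ s in Ico (0 : ℝ) 1, ℓ s ≤ (μH[1] : Measure E2).real (frontier Ω) := by
  obtain ⟨Λ, hΛ⟩ := h.exists_speed_le
  set m : ℝ → ℝ := fun s => (μH[1] : Measure E2).real (γ '' Ico 0 s) with hm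
  have hfin : ∀ {a b : ℝ}, 0 ≤ a → b ≤ 1 → μH[1] (γ '' Ico a b) ≠ ⊤ := by
    intro a b ha hb
    refine ne_top_of_le_ne_top h.hausdorffMeasure_frontier_lt_top.ne (measure_mono ?_)
    rw [← h.image_eq]
    exact image_mono (Ico_subset_Ico ha hb)
  have hadd : ∀ {a b : ℝ}, 0 ≤ a → a ≤ b → b ≤ 1 →
      m b = m a + (μH[1] : Measure E2).real (γ '' Ico a b) := by
    intro a b ha hab hb
    simp only [hm]
    rw [← Ico_union_Ico_eq_Ico ha hab, image_union,
      measureReal_union ?_ ?_ (hfin le_rfl (hab.trans hb)) (hfin ha hb)]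
    · rw [Set.disjoint_left]
      rintro _ ⟨s, hs, rfl⟩ ⟨t, ht, e⟩
      have := h.injOn ⟨ha.trans ht.1, ht.2.trans_le hb⟩ ⟨hs.1, (hs.2.trans_le hab).trans_le hb⟩ e
      linarith [ht.1, hs.2]
    · exact measurableSet_Ico.image_of_continuousOn_injOn h.continuous_curve.continuousOn
        (h.injOn.mono (Ico_subset_Ico ha hb))
  have hlow : ∀ {a b : ℝ}, 0 ≤ a → a ≤ b → b ≤ 1 → dist (γ a) (γ b) ≤ m b - m a := by
    intro a b ha hab hb
    rw [hadd ha hab hb, add_sub_cancel_left, Measure.real, dist_edist]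
    exact ENNReal.toReal_mono (hfin ha hb)
      (edist_le_hausdorffMeasure_image hab h.continuous_curve)
  have hup : ∀ {a b : ℝ}, 0 ≤ a → a ≤ b → b ≤ 1 → m b - m a ≤ Λ * (b - a) := by
    intro a b ha hab hb
    rw [hadd ha hab hb, add_sub_cancel_left, Measure.real]
    have := h.hausdorffMeasure_image_le hΛ (Ico_subset_Ico ha hb)
    rw [Real.volume_Ico] at this
    have h2 := ENNReal.toReal_mono (by finiteness) this
    simpa [hab] using h2
  have hmcont : ContinuousOn m (Icc 0 1) := by
    refine LipschitzOnWith.continuousOn (K := Λ) (LipschitzOnWith.of_dist_le_mul ?_)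
    have : ∀ {a b : ℝ}, a ∈ Icc (0 : ℝ) 1 → b ∈ Icc (0 : ℝ) 1 → a ≤ b →
        dist (m a) (m b) ≤ Λ * dist a b := by
      intro a b ha hb hab
      rw [dist_comm, dist_comm a, Real.dist_eq, Real.dist_eq, abs_of_nonneg (sub_nonneg.2 hab),
        abs_of_nonneg (dist_nonneg.trans (hlow ha.1 hab hb.2))]
      exact hup ha.1 hab hb.2
    intro a ha b hb
    rcases le_total a b with hab | hab
    · exact this ha hb hab
    · rw [dist_comm, dist_comm a]
      exact this hb ha hab
  have hderiv : ∀ x, HasDerivAt (fun s => ∫ t in (0 : ℝ)..s, ℓ t) (ℓ x) x := fun x =>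
    intervalIntegral.integral_hasDerivAt_right (h.continuous_speed.intervalIntegrable _ _)
      h.continuous_speed.stronglyMeasurable.stronglyMeasurableAtFilter
      h.continuous_speed.continuousAt
  have hmain := image_le_of_liminf_slope_right_le_deriv_boundary
    (f := fun s => (∫ t in (0 : ℝ)..s, ℓ t) - m s) (a := 0) (b := 1) (B := fun _ => 0)
    (B' := fun _ => 0)
    (ContinuousOn.sub (fun x _ => (hderiv x).continuousAt.continuousWithinAt) hmcont)
    (by simp [hm]) continuousOn_const (fun x _ => hasDerivWithinAt_const _ _ _) (by
      intro x hx r hr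
      have t1 : Tendsto (slope (fun s => ∫ t in (0 : ℝ)..s, ℓ t) x) (𝓝[>] x) (𝓝 (ℓ x)) :=
        (hderiv x).tendsto_slope.mono_left (nhdsWithin_mono _ fun y hy => ne_of_gt hy)
      have t2 : Tendsto (fun z => ‖slope γ x z‖) (𝓝[>] x) (𝓝 (ℓ x)) := by
        have := ((h.hasDerivAt_curve x).tendsto_slope.mono_left
          (nhdsWithin_mono _ fun y (hy : y ∈ Ioi x) => ne_of_gt hy)).norm
        rwa [norm_smul, h.norm_tangent, mul_one, norm_eq_abs, abs_of_pos (h.speed_pos x)] at this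
      have t3 := t1.sub t2
      rw [sub_self] at t3
      refine Eventually.frequently ?_
      filter_upwards [t3.eventually_lt_const hr, Ioo_mem_nhdsGT hx.2] with z hz hzx
      refine lt_of_le_of_lt ?_ hz
      have hpos : 0 < z - x := sub_pos.2 hzx.1
      have := hlow hx.1 hzx.1.le hzx.2.le
      simp only [slope_def_module, smul_eq_mul, norm_smul, norm_inv, norm_eq_abs,
        abs_of_pos hpos]
      rw [← mul_sub]
      refine mul_le_mul_of_nonneg_left ?_ (inv_nonneg.2 hpos.le)
      rw [← dist_eq_norm, dist_comm]
      linarith)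
  have h1 := hmain (right_mem_Icc.2 zero_le_one)
  simp only [hm, h.image_eq, intervalIntegral.integral_of_le zero_le_one] at h1
  rw [integral_Ico_eq_integral_Ioo, ← integral_Ioc_eq_integral_Ioo]
  linarith

end NormalChart

theorem isClosedEmbedding_line {p v : E2} (hv : ‖v‖ = 1) :
    Topology.IsClosedEmbedding fun t : ℝ => p + t • v := by
  refine Isometry.isClosedEmbedding (Isometry.of_dist_eq fun a b => ?_)
  rw [dist_add_left, dist_eq_norm, ← sub_smul, norm_smul, hv, mul_one, Real.dist_eq, norm_eq_abs]

theorem abs_deriv_comp_line_le {u : E2 → ℝ} (hu : Differentiable ℝ u) {p v : E2} (hv : ‖v‖ = 1)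
    (t : ℝ) : |deriv (fun t : ℝ => u (p + t • v)) t| ≤ ‖fderiv ℝ u (p + t • v)‖ := by
  have h1 : HasDerivAt (fun t : ℝ => p + t • v) v t := by
    simpa using ((hasDerivAt_id t).smul_const v).const_add p
  have h2 := (hu (p + t • v)).hasFDerivAt.comp_hasDerivAt t h1
  have h3 : deriv (fun t : ℝ => u (p + t • v)) t = fderiv ℝ u (p + t • v) v := h2.deriv
  rw [h3, ← norm_eq_abs]
  simpa [hv] using (fderiv ℝ u (p + t • v)).le_opNorm v

theorem contDiff_comp_line {n : WithTop ℕ∞} {u : E2 → ℝ} (hu : ContDiff ℝ n u) (p v : E2) :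
    ContDiff ℝ n fun t : ℝ => u (p + t • v) :=
  hu.comp (contDiff_const.add (contDiff_id.smul contDiff_const))

theorem HasCompactSupport.sq {X : Type*} [TopologicalSpace X] {g : X → ℝ}
    (hc : HasCompactSupport g) : HasCompactSupport fun x => g x ^ 2 :=
  hc.comp_left (g := fun x => x ^ 2) (by simp)

theorem integrable_sq_of_hasCompactSupport {X : Type*} [TopologicalSpace X] [MeasurableSpace X]
    [OpensMeasurableSpace X] {μ : Measure X} [IsFiniteMeasureOnCompacts μ] {g : X → ℝ}
    (hg : Continuous g) (hc : HasCompactSupport g) : Integrable (fun x => g x ^ 2) μ := by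
  have h : Continuous fun x => g x ^ 2 := hg.pow 2
  exact h.integrable_of_hasCompactSupport hc.sq

theorem sq_le_integral_Ioi {g : ℝ → ℝ} (hg : ContDiff ℝ 1 g) (hc : HasCompactSupport g)
    {δ : ℝ} (hδ : 0 < δ) :
    g 0 ^ 2 ≤ ∫ t in Ioi (0 : ℝ), (δ * deriv g t ^ 2 + g t ^ 2 / δ) := by
  have hg2 : ContDiff ℝ 1 fun t => g t ^ 2 := hg.pow 2
  have e := hc.sq.integral_Ioi_deriv_eq hg2 0
  have i1 : Integrable fun t => deriv (fun t => g t ^ 2) t :=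
    (hg2.continuous_deriv le_rfl).integrable_of_hasCompactSupport hc.sq.deriv
  have i2 : Integrable fun t => δ * deriv g t ^ 2 + g t ^ 2 / δ :=
    ((integrable_sq_of_hasCompactSupport (hg.continuous_deriv le_rfl) hc.deriv).const_mul δ).add
      ((integrable_sq_of_hasCompactSupport hg.continuous hc).div_const δ)
  have : g 0 ^ 2 = ∫ t in Ioi (0 : ℝ), -deriv (fun t => g t ^ 2) t := by
    rw [integral_neg, e, neg_neg]
  rw [this]
  refine integral_mono i1.integrableOn.neg i2.integrableOn fun t => ?_
  have : deriv (fun t => g t ^ 2) t = 2 * g t * deriv g t := by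
    rw [deriv_fun_pow (hg.differentiable one_ne_zero t)]
    simp
  simp only [this]
  have : δ * deriv g t ^ 2 + g t ^ 2 / δ + 2 * g t * deriv g t = δ * (deriv g t + g t / δ) ^ 2 := by
    field_simp
    ring
  nlinarith [mul_nonneg hδ.le (sq_nonneg (deriv g t + g t / δ))]

namespace NormalChart

variable {Ω : Set E2} {γ N T : ℝ → E2} {ℓ k : ℝ → ℝ}

theorem mul_integral_sq_le (h : NormalChart Ω γ N T ℓ k) {m : ℝ}
    (hm : ∀ s ∈ Ico (0 : ℝ) 1, m ≤ ℓ s) {u : E2 → ℝ} (hu : ContDiff ℝ 1 u)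
    (hc : HasCompactSupport u) {δ : ℝ} (hδ : 0 < δ) :
    m * ∫ s in Ico (0 : ℝ) 1, u (γ s) ^ 2 ≤
      δ * (∫ x in extDom Ω, ‖fderiv ℝ u x‖ ^ 2) + (∫ x in extDom Ω, u x ^ 2) / δ := by
  have hsq : Continuous fun x => u x ^ 2 := hu.continuous.pow 2
  have hd : Continuous fun x => ‖fderiv ℝ u x‖ ^ 2 := (hu.continuous_fderiv one_ne_zero).norm.pow 2
  have hdc : HasCompactSupport fun x => ‖fderiv ℝ u x‖ ^ 2 := (hc.fderiv ℝ).norm.sq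
  have i1 := hd.integrable_of_hasCompactSupport (μ := volume) hdc
  have i2 := hsq.integrable_of_hasCompactSupport (μ := volume) hc.sq
  set F : E2 → ℝ := fun x => δ * ‖fderiv ℝ u x‖ ^ 2 + u x ^ 2 / δ with hF
  have hFc : Continuous F := (hd.const_mul δ).add (hsq.div_const δ)
  have hFs : HasCompactSupport F :=
    HasCompactSupport.add (hdc.comp_left (g := fun x => δ * x) (by simp))
      (hc.sq.comp_left (g := fun x => x / δ) (by simp))
  have hF0 : ∀ x, 0 ≤ F x := fun x => by positivity
  have iF : IntegrableOn F (extDom Ω) := (hFc.integrable_of_hasCompactSupport hFs).integrableOn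
  have eF : ∫ x in extDom Ω, F x =
      δ * (∫ x in extDom Ω, ‖fderiv ℝ u x‖ ^ 2) + (∫ x in extDom Ω, u x ^ 2) / δ := by
    simp only [hF]
    rw [integral_add (i1.integrableOn.const_mul δ) (i2.integrableOn.div_const δ),
      integral_const_mul, integral_div]
  rw [← eF, h.integral_eq_iterated iF, ← integral_const_mul]
  have iP := (h.integrableOn_iff F).1 iF
  rw [IntegrableOn, Measure.volume_eq_prod, ← Measure.prod_restrict] at iP
  refine setIntegral_mono_on ?_ iP.integral_prod_left measurableSet_Ico fun s hs => ?_
  · exact (((hsq.comp h.continuous_curve).const_mul m).integrableOn_Icc (a := 0) (b := 1)).mono_set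
      Ico_subset_Icc_self
  have hemb := isClosedEmbedding_line (p := γ s) (h.norm_normal s)
  have hFl : Continuous fun t : ℝ => F (γ s + t • N s) := hFc.comp hemb.continuous
  have hFlc : HasCompactSupport fun t : ℝ => F (γ s + t • N s) :=
    hFs.comp_isClosedEmbedding hemb
  set g : ℝ → ℝ := fun t => u (γ s + t • N s) with hg
  have hg1 : ContDiff ℝ 1 g := contDiff_comp_line hu _ _
  have hgc : HasCompactSupport g := hc.comp_isClosedEmbedding hemb
  rcases le_or_gt m 0 with hm0 | hm0
  · refine (mul_nonpos_of_nonpos_of_nonneg hm0 (sq_nonneg _)).trans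
      (setIntegral_nonneg measurableSet_Ioi fun t ht => ?_)
    have := h.speed_pos s
    have := h.turning_nonneg s
    have := mem_Ioi.1 ht
    have := hF0 (γ s + t • N s)
    positivity
  have h0 := sq_le_integral_Ioi hg1 hgc hδ
  have e0 : g 0 = u (γ s) := by simp [hg]
  rw [e0] at h0
  refine (mul_le_mul_of_nonneg_left h0 hm0.le).trans ?_
  rw [← integral_const_mul]
  refine setIntegral_mono_on ?_ ?_ measurableSet_Ioi fun t ht => ?_
  · have j1 := integrable_sq_of_hasCompactSupport (μ := volume) (hg1.continuous_deriv le_rfl)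
      hgc.deriv
    have j2 := integrable_sq_of_hasCompactSupport (μ := volume) hg1.continuous hgc
    exact (((j1.const_mul δ).add (j2.div_const δ)).const_mul m).integrableOn
  · exact (Continuous.integrable_of_hasCompactSupport (by fun_prop) hFlc.mul_left).integrableOn
  · have hd := abs_deriv_comp_line_le (hu.differentiable one_ne_zero) (p := γ s)
      (h.norm_normal s) t
    have hle : δ * deriv g t ^ 2 + g t ^ 2 / δ ≤ F (γ s + t • N s) := by
      exact add_le_add (mul_le_mul_of_nonneg_left
        (sq_le_sq' (neg_le_of_abs_le hd) (le_of_abs_le hd)) hδ.le) le_rfl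
    have : m ≤ ℓ s + t * k s := by
      have := mul_nonneg (le_of_lt ht) (h.turning_nonneg s)
      linarith [hm s hs]
    exact mul_le_mul this hle (by positivity) (hm0.le.trans this)

/-- Rayleigh quotients of the exterior Robin form are bounded below. -/
theorem bddBelow_rayleigh (h : NormalChart Ω γ N T ℓ k) {α : ℝ} (hα : α < 0) :
    BddBelow { q : ℝ | ∃ u : E2 → ℝ, ContDiff ℝ (⊤ : ℕ∞) u ∧ HasCompactSupport u ∧
    (∃ x ∈ extDom Ω, u x ≠ 0) ∧
    q = ((∫ x in extDom Ω, ‖fderiv ℝ u x‖ ^ 2) +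
          α * ∫ x in frontier Ω, (u x) ^ 2 ∂(μH[1])) /
        (∫ x in extDom Ω, (u x) ^ 2) } := by
  obtain ⟨Λ, hΛ⟩ := h.exists_speed_le
  obtain ⟨s₀, -, hmin⟩ := (isCompact_Icc (a := (0 : ℝ)) (b := 1)).exists_isMinOn
    (nonempty_Icc.2 zero_le_one) h.continuous_speed.continuousOn
  set m := ℓ s₀
  have hm0 : 0 < m := h.speed_pos s₀
  have hm : ∀ s ∈ Ico (0 : ℝ) 1, m ≤ ℓ s := fun s hs => hmin (Ico_subset_Icc_self hs)
  have hΛ0 : 0 < (Λ : ℝ) := (h.speed_pos 0).trans_le (hΛ 0 (by simp))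
  set δ : ℝ := m / (-α * Λ) with hδ'
  have hα' : 0 < -α := neg_pos.2 hα
  have hδ : 0 < δ := by positivity
  refine ⟨-(-α * Λ / (m * δ)), ?_⟩
  rintro _ ⟨u, hu, hc, -, rfl⟩
  have hM : 0 ≤ ∫ x in extDom Ω, u x ^ 2 := integral_nonneg fun x => sq_nonneg _
  rcases hM.eq_or_lt with h0 | hpos
  · rw [← h0, div_zero, neg_nonpos]
    positivity
  rw [le_div_iff₀ hpos]
  have hsq : Continuous fun x => u x ^ 2 := hu.continuous.pow 2
  have h1 := h.integral_frontier_le hΛ hsq fun x => sq_nonneg (u x)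
  have h2 := h.mul_integral_sq_le hm (hu.of_le (by exact_mod_cast le_top)) hc hδ
  set A := ∫ x in extDom Ω, ‖fderiv ℝ u x‖ ^ 2
  set M := ∫ x in extDom Ω, u x ^ 2
  set I := ∫ s in Ico (0 : ℝ) 1, u (γ s) ^ 2
  have h3 : -α * ∫ x in frontier Ω, u x ^ 2 ∂(μH[1]) ≤ -α * (Λ * ((δ * A + M / δ) / m)) := by
    refine mul_le_mul_of_nonneg_left (h1.trans ?_) hα'.le
    refine mul_le_mul_of_nonneg_left ?_ hΛ0.le
    rw [le_div_iff₀ hm0]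
    linarith
  have e : -α * (Λ * ((δ * A + M / δ) / m)) = A + (-α * Λ / (m * δ)) * M := by
    have : -α * Λ * δ = m := by
      rw [hδ', mul_div_cancel₀ _ (by positivity)]
    field_simp
    linear_combination A * δ * this
  linarith

end NormalChart

theorem LipschitzWith.exists_contDiff_norm_fderiv_le {f : E2 → ℝ} (hf : LipschitzWith 1 f)
    {ε : ℝ} (hε : 0 < ε) : ∃ g : E2 → ℝ, ContDiff ℝ (⊤ : ℕ∞) g ∧
      (∀ x, ‖fderiv ℝ g x‖ ≤ 1) ∧ ∀ x, |g x - f x| ≤ ε := by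
  let φ : ContDiffBump (0 : E2) := ⟨ε / 2, ε, half_pos hε, half_lt_self hε⟩
  set w : E2 → ℝ := φ.normed volume with hw
  have hwc : HasCompactSupport w := φ.hasCompactSupport_normed
  have hwi : Integrable w := φ.continuous_normed.integrable_of_hasCompactSupport hwc
  have hloc : LocallyIntegrable f := hf.continuous.locallyIntegrable
  set g : E2 → ℝ := w ⋆[ContinuousLinearMap.lsmul ℝ ℝ, volume] f with hg
  have hex : ∀ x, Integrable fun t => w t * f (x - t) := fun x =>
    hwc.convolutionExists_left (ContinuousLinearMap.lsmul ℝ ℝ) φ.continuous_normed hloc x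
  have hgx : ∀ x, g x = ∫ t, w t * f (x - t) := fun x => convolution_lsmul
  have hlip : LipschitzWith 1 g := by
    refine LipschitzWith.of_dist_le_mul fun x y => ?_
    rw [hgx, hgx, dist_eq_norm, ← integral_sub (hex x) (hex y), NNReal.coe_one, one_mul]
    refine (norm_integral_le_of_norm_le (hwi.mul_const (dist x y))
      (Eventually.of_forall fun t => ?_)).trans_eq ?_
    · rw [← mul_sub, norm_mul, norm_eq_abs, abs_of_nonneg (φ.nonneg_normed t)]
      refine mul_le_mul_of_nonneg_left ?_ (φ.nonneg_normed t)
      have := hf.dist_le_mul (x - t) (y - t)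
      rwa [NNReal.coe_one, one_mul, dist_sub_right, dist_eq_norm] at this
    · rw [integral_mul_const, φ.integral_normed, one_mul]
  refine ⟨g, hwc.contDiff_convolution_left _ φ.contDiff_normed hloc, fun x => ?_, fun x => ?_⟩
  · simpa using norm_fderiv_le_of_lipschitz ℝ hlip (x₀ := x)
  · rw [← Real.dist_eq]
    refine φ.dist_normed_convolution_le hf.continuous.aestronglyMeasurable fun y hy => ?_
    have := hf.dist_le_mul y x
    rw [NNReal.coe_one, one_mul] at this
    exact this.trans (mem_ball.1 hy).le

theorem HasCompactSupport.comp_of_abs_sub_infDist_le {Ω : Set E2} (hne : Ω.Nonempty)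
    (hb : IsBounded Ω) {f : ℝ → ℝ} (hf : HasCompactSupport f) (a : ℝ) :
    ∃ K : Set E2, IsCompact K ∧ ∀ d : E2 → ℝ, (∀ x, |d x - infDist x Ω| ≤ a) →
      ∀ x ∉ K, f (d x) = 0 := by
  obtain ⟨M, hM⟩ := hf.isCompact.isBounded.exists_norm_le
  refine ⟨closure {x | infDist x Ω < M + a + 1},
    (NormalChart.isBounded_infDist_lt hne hb _).isCompact_closure, fun d hd x hx => ?_⟩
  by_contra h0
  refine hx (subset_closure ?_)
  have h1 := hM _ (subset_tsupport f h0)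
  rw [norm_eq_abs] at h1
  have h2 := abs_le.1 (hd x)
  have h3 := le_of_abs_le h1
  change infDist x Ω < M + a + 1
  linarith

theorem tendsto_integral_comp_infDist {Ω : Set E2} (hne : Ω.Nonempty) (hb : IsBounded Ω)
    {μ : Measure E2} [IsFiniteMeasureOnCompacts μ] {f : ℝ → ℝ} (hfc : Continuous f)
    (hf : HasCompactSupport f) {d : ℕ → E2 → ℝ} (hdc : ∀ n, Continuous (d n))
    (hd : ∀ n x, |d n x - infDist x Ω| ≤ 1 / (n + 1)) :
    Tendsto (fun n => ∫ x, f (d n x) ∂μ) atTop (𝓝 (∫ x, f (infDist x Ω) ∂μ)) := by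
  obtain ⟨K, hK, h0⟩ := hf.comp_of_abs_sub_infDist_le hne hb 1
  obtain ⟨c, hc⟩ := hfc.bounded_above_of_compact_support hf
  refine tendsto_integral_of_dominated_convergence (K.indicator fun _ => c)
    (fun n => (hfc.comp (hdc n)).aestronglyMeasurable) ?_ (fun n => Eventually.of_forall fun x => ?_)
    (Eventually.of_forall fun x => ?_)
  · exact (integrable_indicator_iff hK.measurableSet).2 (integrableOn_const hK.measure_ne_top)
  · by_cases hx : x ∈ K
    · simpa [hx] using hc (d n x)
    · rw [h0 (d n) (fun x => (hd n x).trans ?_) x hx]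
      · simp [hx]
      · rw [div_le_one (by positivity)]
        simp
  · refine (hfc.tendsto _).comp ?_
    rw [tendsto_iff_dist_tendsto_zero]
    exact squeeze_zero (fun n => dist_nonneg) (fun n => by simpa [Real.dist_eq] using hd n x)
      tendsto_one_div_add_atTop_nhds_zero_nat

theorem isOpen_extDom (Ω : Set E2) : IsOpen (extDom Ω) := isClosed_closure.isOpen_compl

theorem integral_sq_extDom_pos {Ω : Set E2} {u : E2 → ℝ} (hu : Continuous u)
    (hc : HasCompactSupport u) (h0 : ∃ x ∈ extDom Ω, u x ≠ 0) :
    0 < ∫ x in extDom Ω, u x ^ 2 := by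
  obtain ⟨x, hx, hux⟩ := h0
  rw [setIntegral_pos_iff_support_of_nonneg_ae (Eventually.of_forall fun x => sq_nonneg _)
    (integrable_sq_of_hasCompactSupport hu hc).integrableOn]
  refine IsOpen.measure_pos volume (IsOpen.inter ?_ (isOpen_extDom Ω)) ⟨x, pow_ne_zero 2 hux, hx⟩
  exact (hu.pow 2).isOpen_support

namespace NormalChart

variable {Ω : Set E2} {γ N T : ℝ → E2} {ℓ k : ℝ → ℝ}

theorem frontier_subset_closure_extDom (h : NormalChart Ω γ N T ℓ k) :
    frontier Ω ⊆ closure (extDom Ω) := by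
  rw [← h.image_eq]
  rintro _ ⟨s, hs, rfl⟩
  have hcont : Continuous fun t : ℝ => γ s + t • N s :=
    (isClosedEmbedding_line (h.norm_normal s)).continuous
  have ht : Tendsto (fun t : ℝ => γ s + t • N s) (𝓝[>] 0) (𝓝 (γ s)) := by
    simpa using (hcont.tendsto 0).mono_left nhdsWithin_le_nhds
  refine mem_closure_of_tendsto ht ?_
  filter_upwards [self_mem_nhdsWithin] with t ht using h.mem_extDom hs ht

theorem robinEig_mul_le (h : NormalChart Ω γ N T ℓ k) {α : ℝ} (hα : α < 0) {u : E2 → ℝ}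
    (hu : ContDiff ℝ (⊤ : ℕ∞) u) (hc : HasCompactSupport u) :
    robinEig α Ω * ∫ x in extDom Ω, u x ^ 2 ≤ (∫ x in extDom Ω, ‖fderiv ℝ u x‖ ^ 2) +
      α * ∫ x in frontier Ω, u x ^ 2 ∂(μH[1]) := by
  by_cases h0 : ∃ x ∈ extDom Ω, u x ≠ 0
  · rw [← le_div_iff₀ (integral_sq_extDom_pos hu.continuous hc h0)]
    exact csInf_le (h.bddBelow_rayleigh hα) ⟨u, hu, hc, h0, rfl⟩
  push Not at h0
  have h1 : ∀ x ∈ frontier Ω, u x = 0 := fun x hx =>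
    closure_minimal (fun y hy => h0 y hy) (isClosed_singleton.preimage hu.continuous)
      (h.frontier_subset_closure_extDom hx)
  have e1 : ∫ x in extDom Ω, u x ^ 2 = 0 :=
    setIntegral_eq_zero_of_forall_eq_zero fun x hx => by simp [h0 x hx]
  have e2 : ∫ x in frontier Ω, u x ^ 2 ∂(μH[1]) = 0 :=
    setIntegral_eq_zero_of_forall_eq_zero fun x hx => by simp [h1 x hx]
  rw [e1, e2, mul_zero, mul_zero, add_zero]
  exact integral_nonneg fun x => sq_nonneg _

/-- Test functions depending on the distance to the boundary. -/
theorem robinEig_mul_le_of_radial (h : NormalChart Ω γ N T ℓ k) (hne : Ω.Nonempty)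
    (hb : IsBounded Ω) {α : ℝ} (hα : α < 0) {ψ : ℝ → ℝ} (hψ : ContDiff ℝ (⊤ : ℕ∞) ψ)
    (hc : HasCompactSupport ψ) :
    robinEig α Ω * ∫ t in Ioi (0 : ℝ),
        ((∫ s in Ico (0 : ℝ) 1, ℓ s) + t * ∫ s in Ico (0 : ℝ) 1, k s) * ψ t ^ 2 ≤
      (∫ t in Ioi (0 : ℝ),
        ((∫ s in Ico (0 : ℝ) 1, ℓ s) + t * ∫ s in Ico (0 : ℝ) 1, k s) * deriv ψ t ^ 2) +
      α * (∫ s in Ico (0 : ℝ) 1, ℓ s) * ψ 0 ^ 2 := by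
  choose d hd1 hd2 hd3 using fun n : ℕ =>
    (lipschitz_infDist_pt Ω).exists_contDiff_norm_fderiv_le (Nat.one_div_pos_of_nat (α := ℝ) (n := n))
  have hdc : ∀ n, Continuous (d n) := fun n => (hd1 n).continuous
  have hψ1 : Continuous fun t => ψ t ^ 2 := hψ.continuous.pow 2
  have hψ2 : Continuous fun t => deriv ψ t ^ 2 :=
    (hψ.continuous_deriv (by exact_mod_cast le_top)).pow 2
  have hint : ∀ f : ℝ → ℝ, Continuous f → HasCompactSupport f →
      IntegrableOn (fun x => f (infDist x Ω)) (extDom Ω) := by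
    intro f hfc hf
    obtain ⟨K, hK, h0⟩ := hf.comp_of_abs_sub_infDist_le hne hb 0
    exact ((hfc.comp (continuous_infDist_pt Ω)).integrable_of_hasCompactSupport
      (HasCompactSupport.intro hK (h0 _ (by simp)))).integrableOn
  rw [← h.integral_comp_infDist (f := fun t => ψ t ^ 2) (hint _ hψ1 hc.sq),
    ← h.integral_comp_infDist (f := fun t => deriv ψ t ^ 2) (hint _ hψ2 hc.deriv.sq)]
  have t1 := tendsto_integral_comp_infDist hne hb (μ := volume.restrict (extDom Ω)) hψ1 hc.sq
    hdc hd3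
  have t2 := tendsto_integral_comp_infDist hne hb (μ := volume.restrict (extDom Ω)) hψ2
    hc.deriv.sq hdc hd3
  have : IsFiniteMeasure ((μH[1] : Measure E2).restrict (frontier Ω)) :=
    isFiniteMeasure_restrict.2 h.hausdorffMeasure_frontier_lt_top.ne
  have t3 := tendsto_integral_comp_infDist hne hb
    (μ := (μH[1] : Measure E2).restrict (frontier Ω)) hψ1 hc.sq hdc hd3
  have e3 : ∫ x in frontier Ω, ψ (infDist x Ω) ^ 2 ∂(μH[1]) =
      (μH[1] : Measure E2).real (frontier Ω) * ψ 0 ^ 2 := by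
    rw [setIntegral_congr_fun (g := fun _ => ψ 0 ^ 2) isClosed_frontier.measurableSet fun x hx => ?_]
    · simp
    · simp only [infDist_zero_of_mem_closure (frontier_subset_closure hx)]
  rw [e3] at t3
  refine le_trans (le_of_tendsto_of_tendsto' (t1.const_mul (robinEig α Ω))
    (t2.add (t3.const_mul α)) fun n => ?_) ?_
  · have hcs : HasCompactSupport fun x => ψ (d n x) := by
      obtain ⟨K, hK, h0⟩ := hc.comp_of_abs_sub_infDist_le hne hb (1 / (n + 1))
      exact HasCompactSupport.intro hK (h0 _ (hd3 n))
    have hsm : ContDiff ℝ (⊤ : ℕ∞) fun x => ψ (d n x) := hψ.comp (hd1 n)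
    refine (h.robinEig_mul_le hα hsm hcs).trans ?_
    refine add_le_add ?_ le_rfl
    have hcs' : HasCompactSupport fun x => deriv ψ (d n x) := by
      obtain ⟨K, hK, h0⟩ := hc.deriv.comp_of_abs_sub_infDist_le hne hb (1 / (n + 1))
      exact HasCompactSupport.intro hK (h0 _ (hd3 n))
    refine integral_mono
      (integrable_sq_of_hasCompactSupport (hsm.continuous_fderiv (by simp)).norm
        (hcs.fderiv ℝ).norm).integrableOn
      (integrable_sq_of_hasCompactSupport ((hψ.continuous_deriv (by exact_mod_cast le_top)).comp
        (hdc n)) hcs').integrableOn fun x => ?_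
    have hchain : fderiv ℝ (fun x => ψ (d n x)) x = deriv ψ (d n x) • fderiv ℝ (d n) x :=
      (((hψ.differentiable (by simp)) (d n x)).hasDerivAt.comp_hasFDerivAt x
        ((hd1 n).differentiable (by simp) x).hasFDerivAt).fderiv
    simp only [hchain, norm_smul, norm_eq_abs, mul_pow, sq_abs]
    refine mul_le_of_le_one_right (sq_nonneg _) ?_
    exact pow_le_one₀ (norm_nonneg _) (hd2 n x)
  · refine add_le_add le_rfl ?_
    rw [mul_assoc]
    exact mul_le_mul_of_nonpos_left
      (mul_le_mul_of_nonneg_right h.length_le_hausdorffMeasure (sq_nonneg _)) hα.le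

end NormalChart

theorem integrableOn_affine_mul_sq {f : ℝ → ℝ} (hf : Continuous f) (hc : HasCompactSupport f)
    (a b : ℝ) : IntegrableOn (fun t => (a + t * b) * f t ^ 2) (Ioi 0) :=
  (Continuous.integrable_of_hasCompactSupport (by fun_prop) hc.sq.mul_left).integrableOn

theorem integral_affine_mul_sq {f : ℝ → ℝ} (hf : Continuous f) (hc : HasCompactSupport f)
    (a b : ℝ) : ∫ t in Ioi (0 : ℝ), (a + t * b) * f t ^ 2 =
      a * (∫ t in Ioi (0 : ℝ), f t ^ 2) + b * ∫ t in Ioi (0 : ℝ), t * f t ^ 2 := by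
  have i1 : IntegrableOn (fun t => f t ^ 2) (Ioi (0 : ℝ)) :=
    (integrable_sq_of_hasCompactSupport hf hc).integrableOn
  have i2 : IntegrableOn (fun t => t * f t ^ 2) (Ioi (0 : ℝ)) := by
    simpa using integrableOn_affine_mul_sq hf hc 0 1
  rw [← integral_const_mul, ← integral_const_mul, ← integral_add (i1.const_mul a) (i2.const_mul b)]
  exact integral_congr_ae (Eventually.of_forall fun t => by ring)

namespace NormalChart

variable {Ω : Set E2} {γ N T : ℝ → E2} {ℓ k : ℝ → ℝ}

theorem robinEig_nonpos (h : NormalChart Ω γ N T ℓ k) (hne : Ω.Nonempty)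
    (hb : IsBounded Ω) {α : ℝ} (hα : α < 0) : robinEig α Ω ≤ 0 := by
  let χ : ContDiffBump (0 : ℝ) := default
  have hχ : ContDiff ℝ (⊤ : ℕ∞) χ := χ.contDiff
  have hχd : Continuous (deriv χ) := hχ.continuous_deriv (by simp)
  have hχc : HasCompactSupport χ := χ.hasCompactSupport
  set L := ∫ s in Ico (0 : ℝ) 1, ℓ s with hL
  set C := ∫ s in Ico (0 : ℝ) 1, k s with hC
  have hLpos : 0 < L := h.length_pos
  have hC0 : 0 ≤ C := h.turning_integral_nonneg
  set a := ∫ t in Ioi (0 : ℝ), χ t ^ 2 with ha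
  set b := ∫ t in Ioi (0 : ℝ), deriv χ t ^ 2 with hb'
  set b₁ := ∫ t in Ioi (0 : ℝ), t * deriv χ t ^ 2 with hb₁
  have hapos : 0 < a := by
    rw [ha, setIntegral_pos_iff_support_of_nonneg_ae (Eventually.of_forall fun x => sq_nonneg _)
      (integrable_sq_of_hasCompactSupport hχ.continuous hχc).integrableOn]
    refine IsOpen.measure_pos volume ((hχ.continuous.pow 2).isOpen_support.inter isOpen_Ioi)
      ⟨χ.rIn, pow_ne_zero 2 ?_, χ.rIn_pos⟩
    rw [χ.one_of_mem_closedBall (by simp [abs_of_pos χ.rIn_pos])]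
    exact one_ne_zero
  by_contra! hpos
  have key : ∀ ε : ℝ, 0 < ε → ε ≤ 1 → robinEig α Ω * (L * a) ≤ ε * (L * b + C * b₁) := by
    intro ε hε hε1
    set ψ : ℝ → ℝ := fun t => χ (ε * t) with hψ
    have hψs : ContDiff ℝ (⊤ : ℕ∞) ψ := hχ.comp (contDiff_const.mul contDiff_id)
    have hψc : HasCompactSupport ψ :=
      hχc.comp_isClosedEmbedding (Homeomorph.mulLeft₀ ε hε.ne').isClosedEmbedding
    have hψd : deriv ψ = fun t => ε * deriv χ (ε * t) := by
      funext t
      have := ((hχ.differentiable (by simp) (ε * t)).hasDerivAt.comp t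
        ((hasDerivAt_id t).const_mul ε)).deriv
      rw [mul_one, mul_comm] at this
      exact this
    have h1 := h.robinEig_mul_le_of_radial hne hb hα hψs hψc
    rw [← hL, ← hC, integral_affine_mul_sq hψs.continuous hψc,
      integral_affine_mul_sq (hψs.continuous_deriv (by simp)) hψc.deriv] at h1
    have e1 : ∫ t in Ioi (0 : ℝ), ψ t ^ 2 = ε⁻¹ * a := by
      have := integral_comp_mul_left_Ioi (fun t => χ t ^ 2) 0 hε
      rwa [mul_zero, smul_eq_mul] at this
    have e2 : ∫ t in Ioi (0 : ℝ), deriv ψ t ^ 2 = ε * b := by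
      have := integral_comp_mul_left_Ioi (fun t => deriv χ t ^ 2) 0 hε
      rw [mul_zero, smul_eq_mul] at this
      simp only [hψd, mul_pow]
      rw [integral_const_mul, this]
      field_simp
      rfl
    have e3 : ∫ t in Ioi (0 : ℝ), t * deriv ψ t ^ 2 = b₁ := by
      have := integral_comp_mul_left_Ioi (fun t => t * deriv χ t ^ 2) 0 hε
      rw [mul_zero, smul_eq_mul, eq_inv_mul_iff_mul_eq₀ hε.ne', ← integral_const_mul] at this
      rw [hb₁, ← this, hψd]
      exact integral_congr_ae (Eventually.of_forall fun t => by ring)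
    have h2 : 0 ≤ ∫ t in Ioi (0 : ℝ), t * ψ t ^ 2 := setIntegral_nonneg measurableSet_Ioi
      fun t ht => mul_nonneg (le_of_lt ht) (sq_nonneg _)
    have hb0 : 0 ≤ b := integral_nonneg fun t => sq_nonneg _
    rw [e1, e2, e3, mul_add] at h1
    have h3 : α * L * ψ 0 ^ 2 ≤ 0 :=
      mul_nonpos_of_nonpos_of_nonneg (mul_nonpos_of_nonpos_of_nonneg hα.le hLpos.le) (sq_nonneg _)
    have h4 := mul_nonneg hpos.le (mul_nonneg hC0 h2)
    have h5 : robinEig α Ω * (L * (ε⁻¹ * a)) ≤ L * (ε * b) + C * b₁ := by linarith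
    have h6 := mul_le_mul_of_nonneg_left h5 hε.le
    have e4 : ε * (robinEig α Ω * (L * (ε⁻¹ * a))) = robinEig α Ω * (L * a) := by
      field_simp
    rw [e4] at h6
    have h7 : ε * (L * b) ≤ L * b := mul_le_of_le_one_left (by positivity) hε1
    have h8 := mul_le_mul_of_nonneg_left h7 hε.le
    linarith
  obtain ⟨ε, hε0, hε⟩ : ∃ ε : ℝ, 0 < ε ∧ ε ≤ 1 ∧ ε * (L * b + C * b₁) < robinEig α Ω * (L * a) := by
    have hX : 0 < robinEig α Ω * (L * a) := by positivity
    set X := robinEig α Ω * (L * a)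
    set Y := L * b + C * b₁
    refine ⟨min 1 (X / (2 * (|Y| + 1))), by positivity, min_le_left _ _, ?_⟩
    calc _ ≤ min 1 (X / (2 * (|Y| + 1))) * (|Y| + 1) := by
          refine mul_le_mul_of_nonneg_left ?_ (by positivity)
          linarith [le_abs_self Y]
      _ ≤ X / (2 * (|Y| + 1)) * (|Y| + 1) := by
          exact mul_le_mul_of_nonneg_right (min_le_right _ _) (by positivity)
      _ = X / 2 := by field_simp
      _ < X := half_lt_self hX
  exact absurd (key ε hε0 hε.1) (not_le.2 hε.2)

/-- If another chart is a circle, then the eigenvalue comparison follows. -/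
theorem robinEig_le_of_circle (h : NormalChart Ω γ N T ℓ k) (hne : Ω.Nonempty)
    (hb : IsBounded Ω) {α : ℝ} (hα : α < 0) {B : Set E2} {γ' N' T' : ℝ → E2} {R : ℝ}
    (hR : 0 < R) (h' : NormalChart B γ' N' T' (fun _ => 2 * π * R) fun _ => 2 * π)
    (hB : (extDom B).Nonempty)
    (hL : 2 * π * R ≤ ∫ s in Ico (0 : ℝ) 1, ℓ s) : robinEig α Ω ≤ robinEig α B := by
  set L := ∫ s in Ico (0 : ℝ) 1, ℓ s with hLdef
  set C := ∫ s in Ico (0 : ℝ) 1, k s with hCdef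
  have hLpos : 0 < L := h.length_pos
  have hC0 : 0 ≤ C := h.turning_integral_nonneg
  have hC : C ≤ 2 * π := h.turning_integral_le hne hb
  have hneg : robinEig α Ω ≤ 0 := h.robinEig_nonpos hne hb hα
  have hline : ∀ ψ : ℝ → ℝ, ContDiff ℝ (⊤ : ℕ∞) ψ → HasCompactSupport ψ →
      robinEig α Ω * ∫ t in Ioi (0 : ℝ), (2 * π * R + t * (2 * π)) * ψ t ^ 2 ≤
        (∫ t in Ioi (0 : ℝ), (2 * π * R + t * (2 * π)) * deriv ψ t ^ 2) +
          α * (2 * π * R) * ψ 0 ^ 2 := by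
    intro ψ hψ hc
    have h1 := h.robinEig_mul_le_of_radial hne hb hα hψ hc
    have hψd : Continuous (deriv ψ) := hψ.continuous_deriv (by simp)
    have hmono : ∀ f : ℝ → ℝ, Continuous f → HasCompactSupport f →
        ∫ t in Ioi (0 : ℝ), (L + t * C) * f t ^ 2 ≤
          L / (2 * π * R) * ∫ t in Ioi (0 : ℝ), (2 * π * R + t * (2 * π)) * f t ^ 2 := by
      intro f hf hfc
      rw [← integral_const_mul]
      refine setIntegral_mono_on (integrableOn_affine_mul_sq hf hfc L C)
        ((integrableOn_affine_mul_sq hf hfc _ _).const_mul _) measurableSet_Ioi fun t ht => ?_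
      rw [← mul_assoc]
      refine mul_le_mul_of_nonneg_right ?_ (sq_nonneg _)
      have e : L / (2 * π * R) * (2 * π * R + t * (2 * π)) = L + t * (L / R) := by
        field_simp
      rw [e]
      have : C ≤ L / R := by
        rw [le_div_iff₀ hR]
        nlinarith
      have := mul_le_mul_of_nonneg_left this (le_of_lt ht)
      linarith
    have h2 := mul_le_mul_of_nonpos_left (hmono ψ hψ.continuous hc) hneg
    have h3 := hmono (deriv ψ) hψd hc.deriv
    have hq : 0 < L / (2 * π * R) := by positivity
    have e : α * L * ψ 0 ^ 2 = L / (2 * π * R) * (α * (2 * π * R) * ψ 0 ^ 2) := by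
      field_simp
    refine le_of_mul_le_mul_left ?_ hq
    rw [mul_add, ← e]
    linarith
  have hΛ : ∀ s ∈ Ico (0 : ℝ) 1, (fun _ : ℝ => 2 * π * R) s ≤ (2 * π * R).toNNReal :=
    fun s _ => le_coe_toNNReal _
  refine le_csInf ?_ ?_
  · obtain ⟨x, hx⟩ := hB
    obtain ⟨f, -, hfc, hf, -, hfx⟩ := exists_contDiff_tsupport_subset (n := ⊤)
      ((isOpen_extDom B).mem_nhds hx)
    exact ⟨_, f, hf, hfc, ⟨x, hx, by simp_all⟩, rfl⟩
  rintro _ ⟨u, hu, hc, h0, rfl⟩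
  rw [le_div_iff₀ (integral_sq_extDom_pos hu.continuous hc h0)]
  have hu2 : Continuous fun x => u x ^ 2 := hu.continuous.pow 2
  have hfr := h'.integral_frontier_le hΛ hu2 fun x => sq_nonneg _
  rw [coe_toNNReal _ (by positivity)] at hfr
  have hfr' := mul_le_mul_of_nonpos_left hfr hα.le
  refine le_trans ?_ (add_le_add le_rfl hfr')
  have i1 : IntegrableOn (fun x => u x ^ 2) (extDom B) :=
    (integrable_sq_of_hasCompactSupport hu.continuous hc).integrableOn
  have i2 : IntegrableOn (fun x => ‖fderiv ℝ u x‖ ^ 2) (extDom B) :=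
    (integrable_sq_of_hasCompactSupport (hu.continuous_fderiv (by simp)).norm
      (hc.fderiv ℝ).norm).integrableOn
  rw [h'.integral_eq_iterated i1, h'.integral_eq_iterated i2, ← integral_const_mul,
    ← integral_const_mul, ← integral_const_mul]
  have j1 := (h'.integrableOn_iff _).1 i1
  have j2 := (h'.integrableOn_iff _).1 i2
  rw [IntegrableOn, Measure.volume_eq_prod, ← Measure.prod_restrict] at j1 j2
  have j3 : IntegrableOn (fun s => α * (2 * π * R * u (γ' s) ^ 2)) (Ico (0 : ℝ) 1) :=
    ((((hu2.comp h'.continuous_curve).const_mul _).const_mul α).integrableOn_Icc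
      (a := 0) (b := 1)).mono_set Ico_subset_Icc_self
  rw [← integral_add j2.integral_prod_left j3]
  refine integral_mono (j1.integral_prod_left.const_mul _) (j2.integral_prod_left.add j3)
    fun s => ?_
  have hemb := isClosedEmbedding_line (p := γ' s) (h'.norm_normal s)
  have hψ : ContDiff ℝ (⊤ : ℕ∞) fun t : ℝ => u (γ' s + t • N' s) := contDiff_comp_line hu _ _
  have hψc : HasCompactSupport fun t : ℝ => u (γ' s + t • N' s) := hc.comp_isClosedEmbedding hemb
  refine (hline _ hψ hψc).trans ?_
  refine add_le_add ?_ (le_of_eq (by simp only [zero_smul, add_zero]; ring))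
  have hfd : Continuous fun t : ℝ => ‖fderiv ℝ u (γ' s + t • N' s)‖ :=
    (hu.continuous_fderiv (by simp)).norm.comp hemb.continuous
  refine setIntegral_mono_on (integrableOn_affine_mul_sq (hψ.continuous_deriv (by simp))
    hψc.deriv _ _) (integrableOn_affine_mul_sq hfd
      ((hc.fderiv ℝ).norm.comp_isClosedEmbedding hemb) _ _) measurableSet_Ioi fun t ht => ?_
  have ht' := mem_Ioi.1 ht
  refine mul_le_mul_of_nonneg_left ?_ (by positivity)
  have := abs_deriv_comp_line_le (hu.differentiable (by simp)) (p := γ' s) (h'.norm_normal s) t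
  exact sq_le_sq' (neg_le_of_abs_le this) (le_of_abs_le this)

end NormalChart

/-- The unit vector at angle `2πs`. -/
def unitVector (s : ℝ) : E2 := !₂[cos (2 * π * s), sin (2 * π * s)]

/-- The unit vector at angle `2πs`, turned by a right angle. -/
def unitTangent (s : ℝ) : E2 := !₂[-sin (2 * π * s), cos (2 * π * s)]

theorem norm_unitVector (s : ℝ) : ‖unitVector s‖ = 1 := by
  simp [EuclideanSpace.norm_eq, unitVector]

theorem norm_unitTangent (s : ℝ) : ‖unitTangent s‖ = 1 := by
  simp [EuclideanSpace.norm_eq, unitTangent]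

theorem hasDerivAt_unitVector (s : ℝ) :
    HasDerivAt unitVector ((2 * π) • unitTangent s) s := by
  have hl : HasDerivAt (fun s : ℝ => 2 * π * s) (2 * π) s := by
    simpa using (hasDerivAt_id s).const_mul (2 * π)
  have h := (hl.cos.smul_const (EuclideanSpace.single (0 : Fin 2) (1 : ℝ))).add
    (hl.sin.smul_const (EuclideanSpace.single (1 : Fin 2) (1 : ℝ)))
  have e1 : unitVector = (fun s : ℝ => cos (2 * π * s) • EuclideanSpace.single (0 : Fin 2) (1 : ℝ))
      + fun s : ℝ => sin (2 * π * s) • EuclideanSpace.single (1 : Fin 2) (1 : ℝ) := by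
    funext s
    ext i
    fin_cases i <;> simp [unitVector]
  rw [e1]
  refine h.congr_deriv ?_
  ext i
  fin_cases i <;> simp [unitTangent] <;> ring

theorem exists_unitVector_eq {v : E2} (hv : ‖v‖ = 1) : ∃ s ∈ Ico (0 : ℝ) 1, unitVector s = v := by
  set z : ℂ := ⟨v 0, v 1⟩ with hz
  have hn : ‖z‖ = 1 := by
    rw [Complex.norm_def, Complex.normSq_mk, ← hv, EuclideanSpace.norm_eq]
    simp [sq]
  have hz0 : z ≠ 0 := by
    rintro h0
    simp [h0] at hn
  have h1 : cos z.arg = v 0 := by rw [Complex.cos_arg hz0, hn, div_one]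
  have h2 : sin z.arg = v 1 := by rw [Complex.sin_arg, hn, div_one]
  set s := Complex.arg z / (2 * π) with hs
  have e : 2 * π * Int.fract s = Complex.arg z - ⌊s⌋ * (2 * π) := by
    rw [Int.fract, mul_sub, hs, mul_div_cancel₀ _ (by positivity)]
    ring
  refine ⟨Int.fract s, ⟨Int.fract_nonneg _, Int.fract_lt_one _⟩, ?_⟩
  ext i
  fin_cases i <;> simp [unitVector, e, Real.cos_sub_int_mul_two_pi, Real.sin_sub_int_mul_two_pi,
    h1, h2]

theorem injOn_unitVector : InjOn unitVector (Ico 0 1) := by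
  intro s hs t ht h
  have h0 := congrArg (fun v : E2 => v 0) h
  have h1 := congrArg (fun v : E2 => v 1) h
  simp only [unitVector, PiLp.toLp_apply, Matrix.cons_val_zero, Matrix.cons_val_one] at h0 h1
  have hc : cos (2 * π * (s - t)) = 1 := by
    rw [mul_sub, Real.cos_sub, h0, h1, ← sq, ← sq, Real.cos_sq_add_sin_sq]
  have hp := two_pi_pos
  rw [Real.cos_eq_one_iff_of_lt_of_lt (by nlinarith [hs.1, ht.2]) (by nlinarith [hs.2, ht.1])] at hc
  have := (mul_eq_zero.1 hc).resolve_left hp.ne'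
  linarith

theorem normalChart_ball (c : E2) {R : ℝ} (hR : 0 < R) :
    NormalChart (ball c R) (fun s => c + R • unitVector s) unitVector unitTangent
      (fun _ => 2 * π * R) (fun _ => 2 * π) where
  hasDerivAt_curve s := by
    have := ((hasDerivAt_unitVector s).const_smul R).const_add c
    rwa [smul_smul, mul_comm R] at this
  hasDerivAt_normal := hasDerivAt_unitVector
  continuous_speed := continuous_const
  continuous_turning := continuous_const
  speed_pos _ := by positivity
  turning_nonneg _ := by positivity
  norm_normal := norm_unitVector
  norm_tangent := norm_unitTangent
  abs_det s := by
    have : unitTangent s 0 * unitVector s 1 - unitVector s 0 * unitTangent s 1 = -1 := by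
      simp only [unitVector, unitTangent, PiLp.toLp_apply, Matrix.cons_val_zero,
        Matrix.cons_val_one]
      linarith [Real.cos_sq_add_sin_sq (2 * π * s)]
    simp [this]
  support s y hy := by
    rw [closure_ball c hR.ne', mem_closedBall, dist_eq_norm] at hy
    have e : y - (c + R • unitVector s) = (y - c) - R • unitVector s := by abel
    rw [e, inner_sub_right, inner_smul_right, real_inner_self_eq_norm_sq, norm_unitVector]
    have := real_inner_le_norm (unitVector s) (y - c)
    rw [norm_unitVector] at this
    linarith
  injOn := by
    intro s hs t ht h
    exact injOn_unitVector hs ht (smul_right_injective E2 hR.ne' (add_left_cancel h))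
  image_eq := by
    rw [frontier_ball c hR.ne']
    ext x
    constructor
    · rintro ⟨s, -, rfl⟩
      simp [norm_smul, norm_unitVector, hR.le]
    · intro hx
      rw [mem_sphere, dist_eq_norm] at hx
      obtain ⟨s, hs, e⟩ := exists_unitVector_eq (v := R⁻¹ • (x - c)) (by
        rw [norm_smul, hx, norm_inv, norm_eq_abs, abs_of_pos hR, inv_mul_cancel₀ hR.ne'])
      exact ⟨s, hs, by simp [e, smul_smul, hR.ne']⟩
  exists_eq x hx := by
    rw [extDom, closure_ball c hR.ne', mem_compl_iff, mem_closedBall, not_le, dist_eq_norm] at hx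
    have h0 : ‖x - c‖ ≠ 0 := (hR.trans hx).ne'
    obtain ⟨s, hs, e⟩ := exists_unitVector_eq (v := ‖x - c‖⁻¹ • (x - c)) (by
      rw [norm_smul, norm_inv, norm_norm, inv_mul_cancel₀ h0])
    refine ⟨s, hs, ‖x - c‖ - R, sub_pos.2 hx, ?_⟩
    rw [add_assoc, ← add_smul, add_sub_cancel, e, smul_smul, mul_inv_cancel₀ h0, one_smul,
      add_sub_cancel]

/-- Rotation of the plane by a right angle. -/
def quarterTurn : E2 →L[ℝ] E2 :=
  LinearMap.toContinuousLinearMap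
    { toFun := fun v => !₂[-v 1, v 0]
      map_add' := fun v w => by ext i; fin_cases i <;> simp [add_comm]
      map_smul' := fun a v => by ext i; fin_cases i <;> simp }

theorem quarterTurn_apply_zero (v : E2) : quarterTurn v 0 = -v 1 := rfl

theorem quarterTurn_apply_one (v : E2) : quarterTurn v 1 = v 0 := rfl

theorem inner_eq_coords (v w : E2) : inner ℝ v w = v 0 * w 0 + v 1 * w 1 := by
  simp [PiLp.inner_apply, Fin.sum_univ_two, mul_comm]

theorem coords_sq_of_norm_eq_one {v : E2} (hv : ‖v‖ = 1) : v 0 ^ 2 + v 1 ^ 2 = 1 := by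
  have := real_inner_self_eq_norm_sq v
  rw [inner_eq_coords, hv] at this
  linarith

theorem norm_smul_quarterTurn {v : E2} (hv : ‖v‖ = 1) {σ : ℝ} (hσ : σ ^ 2 = 1) :
    ‖σ • quarterTurn v‖ = 1 := by
  have h : ‖σ • quarterTurn v‖ ^ 2 = 1 := by
    rw [← real_inner_self_eq_norm_sq, inner_eq_coords]
    simp only [PiLp.smul_apply, smul_eq_mul, quarterTurn_apply_zero, quarterTurn_apply_one]
    linear_combination (v 0 ^ 2 + v 1 ^ 2) * hσ + coords_sq_of_norm_eq_one hv
  exact (pow_eq_one_iff_of_nonneg (norm_nonneg _) two_ne_zero).1 h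

theorem eq_inner_smul_add_inner_smul {v : E2} (hv : ‖v‖ = 1) {σ : ℝ} (hσ : σ ^ 2 = 1) (w : E2) :
    w = inner ℝ w v • v + inner ℝ w (σ • quarterTurn v) • σ • quarterTurn v := by
  have h := coords_sq_of_norm_eq_one hv
  ext i
  fin_cases i
  · simp only [inner_eq_coords, PiLp.add_apply, PiLp.smul_apply, smul_eq_mul, Fin.zero_eta,
      quarterTurn_apply_zero, quarterTurn_apply_one]
    linear_combination (-(-w 0 * v 1 + w 1 * v 0) * (-v 1)) * hσ - w 0 * h
  · simp only [inner_eq_coords, PiLp.add_apply, PiLp.smul_apply, smul_eq_mul, Fin.mk_one,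
      quarterTurn_apply_zero, quarterTurn_apply_one]
    linear_combination (-(-w 0 * v 1 + w 1 * v 0) * (v 0)) * hσ - w 1 * h

theorem exists_const_sign {b : ℝ → ℝ} (hb : Continuous b) (h0 : ∀ s, b s ≠ 0) :
    ∃ σ : ℝ, σ ^ 2 = 1 ∧ ∀ s, 0 < σ * b s := by
  rcases lt_or_gt_of_ne (h0 0) with h | h
  · refine ⟨-1, by norm_num, fun s => ?_⟩
    by_contra! hs
    obtain ⟨t, ht⟩ := mem_range_of_exists_le_of_exists_ge hb ⟨0, h.le⟩ ⟨s, by linarith⟩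
    exact h0 t ht
  · refine ⟨1, by norm_num, fun s => ?_⟩
    by_contra! hs
    obtain ⟨t, ht⟩ := mem_range_of_exists_le_of_exists_ge hb ⟨s, by linarith⟩ ⟨0, h.le⟩
    exact h0 t ht

theorem exists_mul_inner_le {Ω : Set E2} (ho : IsOpen Ω) (hconv : Convex ℝ Ω) {γ : ℝ → E2}
    {v : E2} {s : ℝ} {c : ℝ} (hγ : HasDerivAt γ (c • v) s) (hc : c ≠ 0) (hv : ‖v‖ = 1)
    (hmem : ∀ t, γ t ∈ frontier Ω) : ∃ a : ℝ,
      (∀ y ∈ Ω, inner ℝ (y - γ s) (quarterTurn v) * a < 0) ∧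
      ∀ y ∈ closure Ω, inner ℝ (y - γ s) (quarterTurn v) * a ≤ 0 := by
  have hs : γ s ∉ Ω := fun h => by
    have := hmem s
    rw [ho.frontier_eq] at this
    exact this.2 h
  obtain ⟨f, hf⟩ := geometric_hahn_banach_open_point hconv ho hs
  have hf' : ∀ y ∈ closure Ω, f y ≤ f (γ s) := fun y hy =>
    closure_minimal (fun y hy => (hf y hy).le) (isClosed_le f.continuous continuous_const) hy
  have hmax : IsLocalMax (fun t => f (γ t)) s :=
    Eventually.of_forall fun t => hf' _ (frontier_subset_closure (hmem t))
  have h0 : f v = 0 := by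
    have := hmax.hasDerivAt_eq_zero (f.hasFDerivAt.comp_hasDerivAt s hγ)
    rw [map_smul, smul_eq_mul] at this
    exact (mul_eq_zero.1 this).resolve_left hc
  have hdec : ∀ w, f w = inner ℝ w (quarterTurn v) * f (quarterTurn v) := fun w => by
    have := congrArg f (eq_inner_smul_add_inner_smul hv (one_pow 2) w)
    simpa only [one_smul, map_add, map_smul, h0, smul_eq_mul, mul_zero, zero_add] using this
  refine ⟨f (quarterTurn v), fun y hy => ?_, fun y hy => ?_⟩
  · rw [← hdec, map_sub, sub_neg]
    exact hf y hy
  · rw [← hdec, map_sub, sub_nonpos]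
    exact hf' y hy

theorem exists_nearest_frontier {Ω : Set E2} (hne : Ω.Nonempty) (ho : IsOpen Ω)
    (hconv : Convex ℝ Ω) {x : E2} (hx : x ∉ closure Ω) :
    ∃ p ∈ frontier Ω, ∀ y ∈ closure Ω, inner ℝ (x - p) (y - p) ≤ 0 := by
  obtain ⟨p, hp, hmin⟩ := exists_norm_eq_iInf_of_complete_convex hne.closure
    isClosed_closure.isComplete hconv.closure x
  have hle := (norm_eq_iInf_iff_real_inner_le_zero hconv.closure hp).1 hmin
  refine ⟨p, ?_, hle⟩
  rw [ho.frontier_eq]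
  refine ⟨hp, fun hpΩ => ?_⟩
  have hcont : Tendsto (fun t : ℝ => p + t • (x - p)) (𝓝[>] 0) (𝓝 p) := by
    have : Continuous fun t : ℝ => p + t • (x - p) := by fun_prop
    simpa using (this.tendsto 0).mono_left nhdsWithin_le_nhds
  obtain ⟨t, ht, ht0⟩ := ((hcont.eventually (ho.mem_nhds hpΩ)).and self_mem_nhdsWithin).exists
  have h1 := hle _ (subset_closure ht)
  rw [add_sub_cancel_left, inner_smul_right, real_inner_self_eq_norm_sq] at h1
  have h2 : 0 < ‖x - p‖ := norm_pos_iff.2 (sub_ne_zero.2 fun h => hx (h ▸ hp))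
  have : 0 < t * ‖x - p‖ ^ 2 := mul_pos ht0 (by positivity)
  linarith

/-- A convex domain with smooth boundary admits a global exterior normal chart. -/
theorem HasSmoothBoundary.exists_normalChart {Ω : Set E2} (hsm : HasSmoothBoundary Ω)
    (hne : Ω.Nonempty) (ho : IsOpen Ω) (hconv : Convex ℝ Ω) :
    ∃ γ N T ℓ k, NormalChart Ω γ N T ℓ k := by
  obtain ⟨γ, hγ, hper, hreg, hinj, hrange⟩ := hsm
  obtain ⟨o, hoΩ⟩ := hne
  have hmem : ∀ t, γ t ∈ frontier Ω := fun t => hrange ▸ mem_range_self t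
  have hv : ContDiff ℝ 1 (deriv γ) := ContDiff.iterate_deriv' 1 1 (contDiff_infty.1 hγ 2)
  set ℓ : ℝ → ℝ := fun s => ‖deriv γ s‖ with hℓ
  have hℓpos : ∀ s, 0 < ℓ s := fun s => norm_pos_iff.2 (hreg s)
  set T : ℝ → E2 := fun s => (ℓ s)⁻¹ • deriv γ s with hT
  have hℓT : ∀ s, ℓ s • T s = deriv γ s := fun s => by
    rw [hT, smul_smul, mul_inv_cancel₀ (hℓpos s).ne', one_smul]
  have hℓd : ContDiff ℝ 1 ℓ := hv.norm ℝ hreg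
  have hTd : ContDiff ℝ 1 T := (hℓd.inv fun s => (hℓpos s).ne').smul hv
  have hTn : ∀ s, ‖T s‖ = 1 := fun s => by
    rw [hT, norm_smul, norm_inv, norm_eq_abs, abs_of_pos (hℓpos s),
      inv_mul_cancel₀ (hℓpos s).ne']
  have hγd : ∀ s, HasDerivAt γ (ℓ s • T s) s := fun s => by
    rw [hℓT]
    exact (hγ.differentiable (by simp) s).hasDerivAt
  choose a ha1 ha2 using fun s => exists_mul_inner_le ho hconv (hγd s) (hℓpos s).ne' (hTn s) hmem
  obtain ⟨σ, hσ, hσpos⟩ := exists_const_sign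
    (b := fun s => -inner ℝ (o - γ s) (quarterTurn (T s)))
    ((continuous_const.sub hγ.continuous).inner (quarterTurn.continuous.comp hTd.continuous)).neg
    fun s h => by
      have := ha1 s o hoΩ
      rw [neg_eq_zero.1 h, zero_mul] at this
      exact lt_irrefl _ this
  have hσa : ∀ s, 0 < σ * a s := fun s => by
    have h1 := ha1 s o hoΩ
    have h2 := hσpos s
    set b := inner ℝ (o - γ s) (quarterTurn (T s))
    have h3 : 0 < (σ * -b) * -(b * a s) := mul_pos h2 (neg_pos.2 h1)
    have h4 : (σ * -b) * -(b * a s) = b ^ 2 * (σ * a s) := by ring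
    rw [h4] at h3
    exact pos_of_mul_pos_right h3 (sq_nonneg b)
  set N : ℝ → E2 := fun s => σ • quarterTurn (T s) with hN
  have hNd : ContDiff ℝ 1 N := (quarterTurn.contDiff.comp hTd).const_smul σ
  have hNn : ∀ s, ‖N s‖ = 1 := fun s => norm_smul_quarterTurn (hTn s) hσ
  have hdec : ∀ s w, w = inner ℝ w (T s) • T s + inner ℝ w (N s) • N s := fun s w =>
    eq_inner_smul_add_inner_smul (hTn s) hσ w
  have hsupp : ∀ s, ∀ y ∈ closure Ω, inner ℝ (N s) (y - γ s) ≤ 0 := fun s y hy => by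
    rw [real_inner_comm, hN, inner_smul_right]
    have h1 := ha2 s y hy
    have h2 := hσa s
    set b := inner ℝ (y - γ s) (quarterTurn (T s))
    have h3 : σ * b * (σ * a s) = b * a s := by linear_combination (b * a s) * hσ
    by_contra! hpos
    have := mul_pos hpos h2
    linarith
  have hstrict : ∀ s, inner ℝ (N s) (o - γ s) < 0 := fun s => by
    rw [real_inner_comm, hN, inner_smul_right]
    linarith [hσpos s]
  have hN' : ∀ s, HasDerivAt N (deriv N s) s := fun s =>
    (hNd.differentiable one_ne_zero s).hasDerivAt
  have horth : ∀ s, inner ℝ (deriv N s) (N s) = 0 := fun s => by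
    have h1 := (hN' s).inner ℝ (hN' s)
    have h2 : (fun t => inner ℝ (N t) (N t)) = fun _ => (1 : ℝ) := by
      funext t
      rw [real_inner_self_eq_norm_sq, hNn, one_pow]
    rw [h2] at h1
    have := h1.unique (hasDerivAt_const s 1)
    rw [real_inner_comm] at this
    linarith
  have himage : γ '' Ico 0 1 = frontier Ω := by
    rw [← hrange]
    refine (image_subset_range _ _).antisymm ?_
    rintro _ ⟨t, rfl⟩
    obtain ⟨s, hs, e⟩ := Function.Periodic.exists_mem_Ico₀ (f := γ) hper one_pos t
    exact ⟨s, hs, e.symm⟩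
  refine ⟨γ, N, T, ℓ, fun s => inner ℝ (deriv N s) (T s), hγd, fun s => ?_, hℓd.continuous,
    (hNd.continuous_deriv le_rfl).inner hTd.continuous, hℓpos, fun s => ?_, hNn, hTn, fun s => ?_,
    hsupp, hinj, himage, fun x hx => ?_⟩
  · refine (hN' s).congr_deriv ?_
    conv_lhs => rw [hdec s (deriv N s), horth, zero_smul, add_zero]
  · have t1 := (hN' s).tendsto_slope
    have t2 := (hγd s).tendsto_slope
    have h0 : 0 ≤ inner ℝ (deriv N s) (ℓ s • T s) := by
      refine ge_of_tendsto' (t1.inner t2) fun t => ?_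
      simp only [slope_def_module, inner_smul_left, inner_smul_right, conj_trivial]
      rw [← mul_assoc, ← sq]
      refine mul_nonneg (sq_nonneg _) ?_
      have e1 := hsupp s (γ t) (frontier_subset_closure (hmem t))
      have e2 := hsupp t (γ s) (frontier_subset_closure (hmem s))
      rw [← neg_sub (γ t), inner_neg_right] at e2
      rw [inner_sub_left]
      linarith
    rw [inner_smul_right] at h0
    exact nonneg_of_mul_nonneg_right h0 (hℓpos s)
  · have e : T s 0 * N s 1 - N s 0 * T s 1 = σ := by
      simp only [hN, PiLp.smul_apply, smul_eq_mul, quarterTurn_apply_zero, quarterTurn_apply_one]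
      linear_combination σ * coords_sq_of_norm_eq_one (hTn s)
    rw [e]
    exact (pow_eq_one_iff_of_nonneg (abs_nonneg _) two_ne_zero).1 (by rw [sq_abs, hσ])
  · obtain ⟨p, hp, hple⟩ := exists_nearest_frontier ⟨o, hoΩ⟩ ho hconv hx
    obtain ⟨s, hs, rfl⟩ := himage.symm ▸ hp
    have hmax : IsLocalMax (fun t => inner ℝ (x - γ s) (γ t - γ s)) s :=
      Eventually.of_forall fun t => by
        simpa using hple _ (frontier_subset_closure (hmem t))
    have h1 := hmax.hasDerivAt_eq_zero
      ((hasDerivAt_const s (x - γ s)).inner ℝ ((hγd s).sub_const (γ s)))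
    rw [inner_zero_left, add_zero, inner_smul_right] at h1
    have h2 := (mul_eq_zero.1 h1).resolve_left (hℓpos s).ne'
    have h3 := hdec s (x - γ s)
    rw [h2, zero_smul, zero_add] at h3
    set τ := inner ℝ (x - γ s) (N s)
    refine ⟨s, hs, τ, ?_, by rw [← h3]; abel⟩
    have h4 := hple o (subset_closure hoΩ)
    rw [h3, inner_smul_left, conj_trivial] at h4
    have h5 := hstrict s
    refine lt_of_le_of_ne ?_ fun h => ?_
    · by_contra! hneg
      have := mul_pos_of_neg_of_neg hneg h5
      linarith
    · rw [← h, zero_smul, sub_eq_zero] at h3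
      exact hx (h3 ▸ frontier_subset_closure hp)

/-- Reverse spectral isochoric inequality in the exterior of a convex set. -/
theorem reverse_spectral_isochoric_exterior
    (α : ℝ) (hα : α < 0) (Ω : Set E2) (hne : Ω.Nonempty) (ho : IsOpen Ω)
    (hb : IsBounded Ω) (hconv : Convex ℝ Ω) (hsm : HasSmoothBoundary Ω)
    (c : E2) (R₂ : ℝ) (hR₂ : 0 < R₂)
    (harea : volume (ball c R₂) = volume Ω) :
    robinEig α Ω ≤ robinEig α (ball c R₂) := by
  obtain ⟨γ, N, T, ℓ, k, h⟩ := hsm.exists_normalChart hne ho hconv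
  have hball := normalChart_ball c hR₂
  exact h.robinEig_le_of_circle hne hb hα hR₂ hball
    ⟨_, hball.mem_extDom (s := 0) (t := 1) (by simp) one_pos⟩
    (h.isoperimetric hne ho hb hconv hR₂ harea)

end
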